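/- arXiv:1603.04193 — 2 statements merged into one kernel-verified Lean document; each statement's English description precedes it below -/
import Mathlib

section
/- Let X ⊆ ℝⁿ be a real algebraic set and let f be a regulous function on X such that Z(f) = {x ∈ X : f(x) = 0} is Zariski closed (i.e. is a real algebraic subset of X). Then the sets S(f) = {f > 0} and S(−f) = {f < 0} are principal open semi-algebraic sets (each equal to {p > 0} for some polynomial function p on X), and the sets {f ≥ 0} and {f ≤ 0} are principal closed semi-algebraic sets (each equal to {p ≥ 0} for some polynomial function p on X). -/
section RegAuxSection
open Polynomial Filter Topology Set
open SignType (sign)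

namespace RegAux

theorem sign_eq_of_isEquivalent {l : Filter ℝ} {u v : ℝ → ℝ}
    (h : Asymptotics.IsEquivalent l u v) : ∀ᶠ y in l, sign (u y) = sign (v y) := by
  obtain ⟨p, hp, he⟩ := h.exists_eq_mul
  have h0 : ∀ᶠ y in l, 0 < p y := hp.eventually (lt_mem_nhds one_pos)
  filter_upwards [h0, he] with y hy h1
  rw [h1]
  simp [sign_mul, sign_pos hy]

theorem lead_data {f k : ℝ[X]} (h : ∀ i, sign (f.coeff i) = sign (k.coeff i)) :
    f.natDegree = k.natDegree ∧ sign f.leadingCoeff = sign k.leadingCoeff := by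
  have hz : ∀ i, f.coeff i = 0 ↔ k.coeff i = 0 := fun i => by
    rw [← sign_eq_zero_iff, h i, sign_eq_zero_iff]
  have hd : f.natDegree = k.natDegree := by
    apply le_antisymm
    · rw [natDegree_le_iff_coeff_eq_zero]
      intro N hN
      exact (hz N).2 (coeff_eq_zero_of_natDegree_lt hN)
    · rw [natDegree_le_iff_coeff_eq_zero]
      intro N hN
      exact (hz N).1 (coeff_eq_zero_of_natDegree_lt hN)
  refine ⟨hd, ?_⟩
  unfold leadingCoeff
  rw [← hd]; exact h _

theorem sign_atTop {f k : ℝ[X]} (h : ∀ i, sign (f.coeff i) = sign (k.coeff i)) :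
    ∃ s, (∀ᶠ y in atTop, sign (f.eval y) = s) ∧ ∀ᶠ y in atTop, sign (k.eval y) = s := by
  obtain ⟨hd, hl⟩ := lead_data h
  refine ⟨sign f.leadingCoeff, ?_, ?_⟩
  · filter_upwards [sign_eq_of_isEquivalent f.isEquivalent_atTop_lead, eventually_gt_atTop 0]
      with y h1 h2
    rw [h1, sign_mul, sign_pos (pow_pos h2 _), mul_one]
  · filter_upwards [sign_eq_of_isEquivalent k.isEquivalent_atTop_lead, eventually_gt_atTop 0]
      with y h1 h2
    rw [h1, sign_mul, sign_pos (pow_pos h2 _), mul_one, hl]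

theorem sign_atBot {f k : ℝ[X]} (h : ∀ i, sign (f.coeff i) = sign (k.coeff i)) :
    ∃ s, (∀ᶠ y in atBot, sign (f.eval y) = s) ∧ ∀ᶠ y in atBot, sign (k.eval y) = s := by
  obtain ⟨hd, hl⟩ := lead_data h
  refine ⟨sign f.leadingCoeff * (-1) ^ f.natDegree, ?_, ?_⟩
  · filter_upwards [sign_eq_of_isEquivalent f.isEquivalent_atBot_lead, eventually_lt_atBot 0]
      with y h1 h2
    rw [h1, sign_mul, sign_pow, sign_neg h2]
  · filter_upwards [sign_eq_of_isEquivalent k.isEquivalent_atBot_lead, eventually_lt_atBot 0]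
      with y h1 h2
    rw [h1, sign_mul, sign_pow, sign_neg h2, hd, hl]

/-- An order automorphism of the line supported in `(l, r)` moving `a` to `b`. -/
theorem exists_bump {l r a b : ℝ} (ha : a ∈ Ioo l r) (hb : b ∈ Ioo l r) :
    ∃ θ : ℝ ≃o ℝ, θ a = b ∧ (∀ y, y ∉ Ioo l r → θ y = y) := by
  obtain ⟨ha1, ha2⟩ := ha
  obtain ⟨hb1, hb2⟩ := hb
  set m1 := (b - l) / (a - l) with hm1
  set m2 := (r - b) / (r - a) with hm2
  have p1 : 0 < m1 := div_pos (by linarith) (by linarith)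
  have p2 : 0 < m2 := div_pos (by linarith) (by linarith)
  have e1 : m1 * (a - l) = b - l := div_mul_cancel₀ _ (by linarith)
  have e2 : m2 * (r - a) = r - b := div_mul_cancel₀ _ (by linarith)
  let t : ℝ → ℝ := fun y => if y ≤ l then y else if y ≤ a then l + m1 * (y - l)
    else if y ≤ r then b + m2 * (y - a) else y
  have hmono : StrictMono t := by
    intro x y hxy
    simp only [t]
    split_ifs <;> nlinarith
  have hsurj : Function.Surjective t := by
    intro z
    by_cases h1 : z ≤ l
    · exact ⟨z, by simp [t, h1]⟩
    by_cases h2 : z ≤ b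
    · refine ⟨l + (z - l) / m1, ?_⟩
      have q : 0 < (z - l) / m1 := div_pos (by linarith) p1
      have q2 : m1 * ((z - l) / m1) = z - l := mul_div_cancel₀ _ p1.ne'
      have h3 : ¬ (l + (z - l) / m1 ≤ l) := by linarith
      have h4 : l + (z - l) / m1 ≤ a := by
        by_contra hc
        nlinarith
      simp only [t, if_neg h3, if_pos h4]
      linarith
    by_cases h5 : z ≤ r
    · refine ⟨a + (z - b) / m2, ?_⟩
      have q : 0 < (z - b) / m2 := div_pos (by linarith) p2
      have q2 : m2 * ((z - b) / m2) = z - b := mul_div_cancel₀ _ p2.ne'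
      have h3 : ¬ (a + (z - b) / m2 ≤ l) := by linarith
      have h4 : ¬ (a + (z - b) / m2 ≤ a) := by linarith
      have h6 : a + (z - b) / m2 ≤ r := by
        by_contra hc
        nlinarith
      simp only [t, if_neg h3, if_neg h4, if_pos h6]
      linarith
    · refine ⟨z, ?_⟩
      have h3 : ¬ (z ≤ a) := by linarith
      simp [t, h1, h3, h5]
  refine ⟨hmono.orderIsoOfSurjective t hsurj, ?_, ?_⟩
  · have : ¬ (a ≤ l) := by linarith
    simp only [StrictMono.coe_orderIsoOfSurjective, t, if_neg this, le_refl, if_true]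
    linarith
  · intro y hy
    simp only [StrictMono.coe_orderIsoOfSurjective, t]
    split_ifs with h1 h2 h3
    · rfl
    · exact absurd ⟨by linarith, by linarith⟩ hy
    · have : y = r := by
        by_contra hne
        exact hy ⟨by linarith, lt_of_le_of_ne h3 hne⟩
      subst this; linarith
    · rfl

/-- Comparison of two injective functions on a segment. -/
theorem sign_eq_of_pos {F K : ℝ → ℝ} {u v y : ℝ} (hy : y ∈ Ioo u v)
    (hF : StrictMonoOn F (Icc u v) ∨ StrictAntiOn F (Icc u v))
    (hK : StrictMonoOn K (Icc u v) ∨ StrictAntiOn K (Icc u v))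
    (hFc : ContinuousOn F (Icc u v))
    (hu : sign (F u) = sign (K u)) (hv : sign (F v) = sign (K v))
    (hz : ∀ z ∈ Icc u v, F z = 0 → K z = 0) (hp : 0 < F y) : 0 < K y := by
  obtain ⟨h1, h2⟩ := hy
  have mu : u ∈ Icc u v := ⟨le_rfl, by linarith⟩
  have mv : v ∈ Icc u v := ⟨by linarith, le_rfl⟩
  have my : y ∈ Icc u v := ⟨by linarith, by linarith⟩
  have key : 0 ≤ K u → 0 ≤ K v → 0 < K y := by
    intro a b
    rcases hK with hK | hK
    · have := hK mu my h1; linarith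
    · have := hK my mv h2; linarith
  have su : 0 ≤ F u → 0 ≤ K u := fun h => by
    rw [← sign_nonneg_iff] at h ⊢; rwa [← hu]
  have sv : 0 ≤ F v → 0 ≤ K v := fun h => by
    rw [← sign_nonneg_iff] at h ⊢; rwa [← hv]
  have su' : 0 < F u → 0 < K u := fun h => by
    rw [← sign_eq_one_iff] at h ⊢; rwa [← hu]
  have sv' : 0 < F v → 0 < K v := fun h => by
    rw [← sign_eq_one_iff] at h ⊢; rwa [← hv]
  rcases hF with hF | hF
  · have a1 := hF my mv h2
    by_cases hc : 0 ≤ F u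
    · exact key (su hc) (sv (by linarith))
    · push Not at hc
      have hsub : Icc u y ⊆ Icc u v := Icc_subset_Icc le_rfl h2.le
      obtain ⟨ρ, hρ, h0⟩ := intermediate_value_Icc h1.le (hFc.mono hsub)
        (show (0:ℝ) ∈ Icc (F u) (F y) from ⟨hc.le, hp.le⟩)
      have hne : ρ ≠ y := by rintro rfl; linarith
      have hlt : ρ < y := lt_of_le_of_ne hρ.2 hne
      have k0 := hz ρ (hsub hρ) h0
      have k1 := sv' (by linarith)
      rcases hK with hK | hK
      · have := hK (hsub hρ) my hlt; linarith
      · have := hK (hsub hρ) mv (hlt.trans h2); linarith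
  · have a1 := hF mu my h1
    by_cases hc : 0 ≤ F v
    · exact key (su (by linarith)) (sv hc)
    · push Not at hc
      have hsub : Icc y v ⊆ Icc u v := Icc_subset_Icc h1.le le_rfl
      obtain ⟨ρ, hρ, h0⟩ := intermediate_value_Icc' h2.le (hFc.mono hsub)
        (show (0:ℝ) ∈ Icc (F v) (F y) from ⟨hc.le, hp.le⟩)
      have hne : y ≠ ρ := by rintro rfl; linarith
      have hlt : y < ρ := lt_of_le_of_ne hρ.1 hne
      have k0 := hz ρ (hsub hρ) h0
      have k1 := su' (by linarith)
      rcases hK with hK | hK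
      · have := hK mu (hsub hρ) (h1.trans hlt); linarith
      · have := hK my (hsub hρ) hlt; linarith

theorem mono_neg {F : ℝ → ℝ} {s : Set ℝ} (hF : StrictMonoOn F s ∨ StrictAntiOn F s) :
    StrictMonoOn (fun y => - F y) s ∨ StrictAntiOn (fun y => - F y) s := by
  rcases hF with h | h
  · right; intro a ha b hb hab; have := h ha hb hab; simp only; linarith
  · left; intro a ha b hb hab; have := h ha hb hab; simp only; linarith

theorem sign_eq_of_inj {F K : ℝ → ℝ} {u v y : ℝ} (hy : y ∈ Ioo u v)
    (hF : StrictMonoOn F (Icc u v) ∨ StrictAntiOn F (Icc u v))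
    (hK : StrictMonoOn K (Icc u v) ∨ StrictAntiOn K (Icc u v))
    (hFc : ContinuousOn F (Icc u v))
    (hu : sign (F u) = sign (K u)) (hv : sign (F v) = sign (K v))
    (hz : ∀ z ∈ Icc u v, F z = 0 → K z = 0) : sign (F y) = sign (K y) := by
  rcases lt_trichotomy (F y) 0 with h | h | h
  · have := sign_eq_of_pos (F := fun y => - F y) (K := fun y => - K y) hy (mono_neg hF)
      (mono_neg hK) hFc.neg (by simp [Left.sign_neg, hu]) (by simp [Left.sign_neg, hv])
      (by simpa using hz) (by simpa using h)
    rw [sign_neg h, sign_neg (by simpa using this)]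
  · rw [h, hz y ⟨hy.1.le, hy.2.le⟩ h]
  · rw [sign_pos h, sign_pos (sign_eq_of_pos hy hF hK hFc hu hv hz h)]

theorem poly_mono {f : ℝ[X]} {u v : ℝ} (huv : u < v)
    (h : ∀ y ∈ Ioo u v, f.derivative.eval y ≠ 0) :
    StrictMonoOn (fun y => f.eval y) (Icc u v) ∨ StrictAntiOn (fun y => f.eval y) (Icc u v) := by
  apply ContinuousOn.strictMonoOn_of_injOn_Icc' huv.le f.continuous.continuousOn
  have key : ∀ a ∈ Icc u v, ∀ b ∈ Icc u v, a < b → f.eval a ≠ f.eval b := by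
    intro a ha b hb hab he
    obtain ⟨c, hc, h0⟩ := exists_deriv_eq_zero (f := fun y => f.eval y) hab
      f.continuous.continuousOn he
    rw [Polynomial.deriv] at h0
    exact h c ⟨lt_of_le_of_lt ha.1 hc.1, lt_of_lt_of_le hc.2 hb.2⟩ h0
  intro a ha b hb he
  rcases lt_trichotomy a b with h1 | h1 | h1
  · exact absurd he (key a ha b hb h1)
  · exact h1
  · exact absurd he.symm (key b hb a ha h1)

/-- a polynomial without roots in an interval has constant sign there -/
theorem poly_sign_const {g : ℝ[X]} {u v : ℝ} (h : ∀ y ∈ Ioo u v, g.eval y ≠ 0) :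
    ∀ y ∈ Ioo u v, ∀ z ∈ Ioo u v, sign (g.eval y) = sign (g.eval z) := by
  have key : ∀ y ∈ Ioo u v, ∀ z ∈ Ioo u v, g.eval y < 0 → 0 < g.eval z → False := by
    intro y hy z hz h1 h2
    obtain ⟨c, hc, h0⟩ := isPreconnected_Ioo.intermediate_value hy hz
      (f := fun y => g.eval y) g.continuous.continuousOn ⟨h1.le, h2.le⟩
    exact h c hc h0
  intro y hy z hz
  rcases lt_or_gt_of_ne (h y hy) with h1 | h1 <;> rcases lt_or_gt_of_ne (h z hz) with h2 | h2
  · rw [sign_neg h1, sign_neg h2]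
  · exact (key y hy z hz h1 h2).elim
  · exact (key z hz y hy h2 h1).elim
  · rw [sign_pos h1, sign_pos h2]


theorem exists_left {Z : Set ℝ} (hZ : Z.Finite) {f k : ℝ[X]} {φ : ℝ ≃o ℝ}
    (hr : ∀ y ∈ Z, sign (f.eval y) = sign (k.eval (φ y)))
    (hc : ∀ i, sign (f.coeff i) = sign (k.coeff i)) (y : ℝ) :
    ∃ u < y, (∀ z ∈ Ioo u y, z ∉ Z) ∧ sign (f.eval u) = sign (k.eval (φ u)) := by
  by_cases h : (Z ∩ Iio y).Nonempty
  · obtain ⟨u, hu, hm⟩ := Set.exists_max_image (Z ∩ Iio y) id (hZ.subset inter_subset_left) h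
    refine ⟨u, hu.2, ?_, hr u hu.1⟩
    intro z hz hzZ
    have := hm z ⟨hzZ, hz.2⟩
    simp only [id] at this
    linarith [hz.1]
  · obtain ⟨s, h1, h2⟩ := sign_atBot hc
    have h3 := φ.tendsto_atBot.eventually h2
    obtain ⟨u, hu1, hu2, hu3⟩ := (h1.and (h3.and (eventually_lt_atBot y))).exists
    refine ⟨u, hu3, ?_, by rw [hu1, hu2]⟩
    intro z hz hzZ
    exact h ⟨z, hzZ, hz.2⟩

theorem exists_right {Z : Set ℝ} (hZ : Z.Finite) {f k : ℝ[X]} {φ : ℝ ≃o ℝ}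
    (hr : ∀ y ∈ Z, sign (f.eval y) = sign (k.eval (φ y)))
    (hc : ∀ i, sign (f.coeff i) = sign (k.coeff i)) (y : ℝ) :
    ∃ v > y, (∀ z ∈ Ioo y v, z ∉ Z) ∧ sign (f.eval v) = sign (k.eval (φ v)) := by
  by_cases h : (Z ∩ Ioi y).Nonempty
  · obtain ⟨u, hu, hm⟩ := Set.exists_min_image (Z ∩ Ioi y) id (hZ.subset inter_subset_left) h
    refine ⟨u, hu.2, ?_, hr u hu.1⟩
    intro z hz hzZ
    have := hm z ⟨hzZ, hz.1⟩
    simp only [id] at this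
    linarith [hz.2]
  · obtain ⟨s, h1, h2⟩ := sign_atTop hc
    have h3 := φ.tendsto_atTop.eventually h2
    obtain ⟨u, hu1, hu2, hu3⟩ := (h1.and (h3.and (eventually_gt_atTop y))).exists
    refine ⟨u, hu3, ?_, by rw [hu1, hu2]⟩
    intro z hz hzZ
    exact h ⟨z, hzZ, hz.1⟩

theorem exists_cell {Z : Set ℝ} (hZ : Z.Finite) {f k : ℝ[X]} {φ : ℝ ≃o ℝ}
    (hr : ∀ y ∈ Z, sign (f.eval y) = sign (k.eval (φ y)))
    (hc : ∀ i, sign (f.coeff i) = sign (k.coeff i)) (y : ℝ) (hy : y ∉ Z) :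
    ∃ u v, u < y ∧ y < v ∧ (∀ z ∈ Ioo u v, z ∉ Z) ∧ sign (f.eval u) = sign (k.eval (φ u)) ∧
      sign (f.eval v) = sign (k.eval (φ v)) := by
  obtain ⟨u, hu, h1, h2⟩ := exists_left hZ hr hc y
  obtain ⟨v, hv, h3, h4⟩ := exists_right hZ hr hc y
  refine ⟨u, v, hu, hv, ?_, h2, h4⟩
  intro z hz
  rcases lt_trichotomy z y with h | h | h
  · exact h1 z ⟨hz.1, h⟩
  · rwa [h]
  · exact h3 z ⟨h, hz.2⟩

theorem comp_mono {K : ℝ → ℝ} {φ : ℝ ≃o ℝ} {u v : ℝ}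
    (h : StrictMonoOn K (Icc (φ u) (φ v)) ∨ StrictAntiOn K (Icc (φ u) (φ v))) :
    StrictMonoOn (fun y => K (φ y)) (Icc u v) ∨ StrictAntiOn (fun y => K (φ y)) (Icc u v) := by
  have hm : ∀ y ∈ Icc u v, φ y ∈ Icc (φ u) (φ v) := fun y hy =>
    ⟨φ.monotone hy.1, φ.monotone hy.2⟩
  rcases h with h | h
  · left; intro a ha b hb hab; exact h (hm a ha) (hm b hb) (φ.strictMono hab)
  · right; intro a ha b hb hab; exact h (hm a ha) (hm b hb) (φ.strictMono hab)

theorem core_final {ι : Type*} {P P' : ι → ℝ[X]} {f k : ℝ[X]} {i0 : ι}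
    (hP : P i0 = derivative f) (hP' : P' i0 = derivative k) (hne : derivative f ≠ 0)
    (hZ : {y | ∃ i, P i ≠ 0 ∧ (P i).eval y = 0}.Finite)
    (hc : ∀ i, sign (f.coeff i) = sign (k.coeff i)) {φ : ℝ ≃o ℝ}
    (hm : ∀ i y, sign ((P i).eval y) = sign ((P' i).eval (φ y)))
    (hr : ∀ y ∈ {y | ∃ i, P i ≠ 0 ∧ (P i).eval y = 0}, sign (f.eval y) = sign (k.eval (φ y)))
    (hb : ∀ y, f.eval y = 0 → k.eval (φ y) = 0) :
    ∀ y, sign (f.eval y) = sign (k.eval (φ y)) := by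
  intro y
  by_cases hy : y ∈ {y | ∃ i, P i ≠ 0 ∧ (P i).eval y = 0}
  · exact hr y hy
  obtain ⟨u, v, hu, hv, hcell, h1, h2⟩ := exists_cell hZ hr hc y hy
  have hd : ∀ z ∈ Ioo u v, (derivative f).eval z ≠ 0 := by
    intro z hz h0
    exact hcell z hz ⟨i0, by rwa [hP], by rwa [hP]⟩
  have hd' : ∀ z ∈ Ioo (φ u) (φ v), (derivative k).eval z ≠ 0 := by
    intro z hz h0
    have hz' : φ.symm z ∈ Ioo u v := by
      constructor
      · rw [φ.lt_symm_apply]; exact hz.1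
      · rw [φ.symm_apply_lt]; exact hz.2
    apply hd _ hz'
    have := hm i0 (φ.symm z)
    rw [hP, hP', φ.apply_symm_apply, h0, sign_zero, sign_eq_zero_iff] at this
    exact this
  exact sign_eq_of_inj (F := fun y => f.eval y) (K := fun y => k.eval (φ y)) ⟨hu, hv⟩
    (poly_mono (hu.trans hv) hd) (comp_mono (poly_mono (φ.strictMono (hu.trans hv)) hd'))
    f.continuous.continuousOn h1 h2 (fun z _ => hb z)

theorem core {ι : Type*} {P P' : ι → ℝ[X]} {f k : ℝ[X]} {i0 : ι}
    (hP : P i0 = derivative f) (hP' : P' i0 = derivative k) (hne : derivative f ≠ 0)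
    (hZ : {y | ∃ i, P i ≠ 0 ∧ (P i).eval y = 0}.Finite)
    (hc : ∀ i, sign (f.coeff i) = sign (k.coeff i)) (N : ℕ) : ∀ {φ : ℝ ≃o ℝ}
    (_ : ∀ i y, sign ((P i).eval y) = sign ((P' i).eval (φ y)))
    (_ : ∀ y ∈ {y | ∃ i, P i ≠ 0 ∧ (P i).eval y = 0}, sign (f.eval y) = sign (k.eval (φ y)))
    (_ : {y | f.eval y = 0 ∧ k.eval (φ y) ≠ 0}.ncard ≤ N),
    ∃ ψ : ℝ ≃o ℝ, (∀ i y, sign ((P i).eval y) = sign ((P' i).eval (ψ y))) ∧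
      ∀ y, sign (f.eval y) = sign (k.eval (ψ y)) := by
  have hf0 : f ≠ 0 := by rintro rfl; simp at hne
  have hfin : ∀ φ : ℝ ≃o ℝ, {y | f.eval y = 0 ∧ k.eval (φ y) ≠ 0}.Finite := by
    intro φ
    apply (Polynomial.finite_setOfPred_isRoot hf0).subset
    intro y hy; exact hy.1
  induction N with
  | zero =>
    intro φ hm hr hN
    refine ⟨φ, hm, core_final hP hP' hne hZ hc hm hr ?_⟩
    intro y hy
    by_contra h
    have : {y | f.eval y = 0 ∧ k.eval (φ y) ≠ 0} = ∅ := by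
      rw [← Set.ncard_eq_zero (hfin φ)]; omega
    have h2 : y ∈ {y | f.eval y = 0 ∧ k.eval (φ y) ≠ 0} := ⟨hy, h⟩
    rw [this] at h2
    exact h2
  | succ N ih =>
    intro φ hm hr hN
    by_cases hemp : {y | f.eval y = 0 ∧ k.eval (φ y) ≠ 0} = ∅
    · exact ih hm hr (by rw [hemp]; simp)
    obtain ⟨ρ, hρ, hkρ⟩ := Set.nonempty_iff_ne_empty.2 hemp
    have hρZ : ρ ∉ {y | ∃ i, P i ≠ 0 ∧ (P i).eval y = 0} := by
      intro h
      have := hr ρ h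
      rw [hρ, sign_zero, eq_comm, sign_eq_zero_iff] at this
      exact hkρ this
    obtain ⟨u, v, hu, hv, hcell, h1, h2⟩ := exists_cell hZ hr hc ρ hρZ
    have hd : ∀ z ∈ Ioo u v, (derivative f).eval z ≠ 0 := by
      intro z hz h0
      exact hcell z hz ⟨i0, by rwa [hP], by rwa [hP]⟩
    have hmono := poly_mono (hu.trans hv) hd
    have mu : u ∈ Icc u v := ⟨le_rfl, (hu.trans hv).le⟩
    have mv : v ∈ Icc u v := ⟨(hu.trans hv).le, le_rfl⟩
    have mρ : ρ ∈ Icc u v := ⟨hu.le, hv.le⟩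
    have huniq : ∀ z ∈ Icc u v, f.eval z = 0 → z = ρ := by
      intro z hz h0
      have hinj : InjOn (fun y => f.eval y) (Icc u v) := by
        rcases hmono with h | h
        · exact h.injOn
        · exact h.injOn
      exact hinj hz mρ (by simp only [h0, hρ])
    have hφuv : φ u < φ v := φ.strictMono (hu.trans hv)
    obtain ⟨ρ', hρ', h0'⟩ : ∃ c ∈ Ioo (φ u) (φ v), k.eval c = 0 := by
      rcases hmono with h | h
      · have a1 := h mu mρ hu
        have a2 := h mρ mv hv
        simp only [hρ] at a1 a2
        rw [sign_neg a1, eq_comm, sign_eq_neg_one_iff] at h1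
        rw [sign_pos a2, eq_comm, sign_eq_one_iff] at h2
        obtain ⟨c, hc, h⟩ := intermediate_value_Ioo hφuv.le (f := fun y => k.eval y)
          k.continuous.continuousOn ⟨h1, h2⟩
        exact ⟨c, hc, h⟩
      · have a1 := h mu mρ hu
        have a2 := h mρ mv hv
        simp only [hρ] at a1 a2
        rw [sign_pos a1, eq_comm, sign_eq_one_iff] at h1
        rw [sign_neg a2, eq_comm, sign_eq_neg_one_iff] at h2
        obtain ⟨c, hc, h⟩ := intermediate_value_Ioo' hφuv.le (f := fun y => k.eval y)
          k.continuous.continuousOn ⟨h2, h1⟩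
        exact ⟨c, hc, h⟩
    obtain ⟨θ, hθ1, hθ2⟩ := exists_bump (l := φ u) (r := φ v) (a := φ ρ) (b := ρ')
      ⟨φ.strictMono hu, φ.strictMono hv⟩ hρ'
    have hout : ∀ y, y ∉ Ioo u v → θ (φ y) = φ y := by
      intro y hy
      apply hθ2
      rintro ⟨h3, h4⟩
      exact hy ⟨φ.lt_iff_lt.1 h3, φ.lt_iff_lt.1 h4⟩
    have hin : ∀ y ∈ Ioo u v, θ (φ y) ∈ Ioo (φ u) (φ v) := by
      intro y hy
      have e1 : θ (φ u) = φ u := hθ2 _ (by simp)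
      have e2 : θ (φ v) = φ v := hθ2 _ (by simp)
      constructor
      · rw [← e1]; exact θ.strictMono (φ.strictMono hy.1)
      · rw [← e2]; exact θ.strictMono (φ.strictMono hy.2)
    refine ih (φ := φ.trans θ) ?_ ?_ ?_
    · intro i y
      rw [OrderIso.trans_apply]
      by_cases hy : y ∈ Ioo u v
      · have hz := hin y hy
        have hz' : φ.symm (θ (φ y)) ∈ Ioo u v := by
          constructor
          · rw [φ.lt_symm_apply]; exact hz.1
          · rw [φ.symm_apply_lt]; exact hz.2
        have := hm i (φ.symm (θ (φ y)))
        rw [φ.apply_symm_apply] at this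
        rw [← this]
        by_cases hPi : P i = 0
        · simp [hPi]
        · exact poly_sign_const (fun z hz h0 => hcell z hz ⟨i, hPi, h0⟩) y hy _ hz'
      · rw [hout y hy]; exact hm i y
    · intro y hy
      rw [OrderIso.trans_apply, hout y (fun h => hcell y h hy)]
      exact hr y hy
    · have hlt : {y | f.eval y = 0 ∧ k.eval ((φ.trans θ) y) ≠ 0}.ncard <
          {y | f.eval y = 0 ∧ k.eval (φ y) ≠ 0}.ncard := by
        apply Set.ncard_lt_ncard _ (hfin φ)
        have hnot : ρ ∉ {y | f.eval y = 0 ∧ k.eval ((φ.trans θ) y) ≠ 0} := by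
          rintro ⟨-, h⟩
          rw [OrderIso.trans_apply, hθ1] at h
          exact h h0'
        refine ⟨?_, fun hsub => hnot (hsub ⟨hρ, hkρ⟩)⟩
        rintro y ⟨hy1, hy2⟩
        refine ⟨hy1, ?_⟩
        rw [OrderIso.trans_apply] at hy2
        by_cases hy : y ∈ Ioo u v
        · have := huniq y ⟨hy.1.le, hy.2.le⟩ hy1
          subst this
          exact hkρ
        · rwa [hout y hy] at hy2
      omega


theorem pseudo {A : Type*} [CommRing A] (g : A[X]) (m : ℕ) (f : A[X]) :
    ∃ r : A[X], r.natDegree ≤ m ∧ ∃ e : ℕ, ∀ φ : A →+* ℝ,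
      (∀ j > m + 1, φ (g.coeff j) = 0) → ∀ y, (g.map φ).eval y = 0 →
        φ (g.coeff (m + 1)) ^ e * (f.map φ).eval y = (r.map φ).eval y := by
  induction hn : f.natDegree using Nat.strong_induction_on generalizing f with
  | _ n ih =>
    by_cases hle : n ≤ m
    · exact ⟨f, by omega, 0, fun φ _ y _ => by simp⟩
    push Not at hle
    obtain ⟨gt, hgt⟩ : ∃ gt : A[X], ∀ j, gt.coeff j = if j < m + 2 then g.coeff j else 0 := by
      refine ⟨∑ i ∈ Finset.range (m + 2), C (g.coeff i) * X ^ i, fun j => ?_⟩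
      simp [coeff_X_pow]
    obtain ⟨t, rfl⟩ : ∃ t, n = t + (m + 1) := ⟨n - (m + 1), by omega⟩
    set f1 := C (g.coeff (m + 1)) * f - C f.leadingCoeff * (X ^ t * gt) with hf1
    have hlt : f1.natDegree < t + (m + 1) := by
      have : f1.natDegree ≤ t + m := by
        rw [natDegree_le_iff_coeff_eq_zero]
        intro N hN
        obtain ⟨s, rfl⟩ : ∃ s, N = s + t := ⟨N - t, by omega⟩
        rw [hf1, coeff_sub, coeff_C_mul, coeff_C_mul, coeff_X_pow_mul, hgt]
        by_cases hs : s = m + 1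
        · subst hs
          rw [if_pos (by omega), leadingCoeff, hn, add_comm t]; ring
        · rw [if_neg (by omega), coeff_eq_zero_of_natDegree_lt (p := f) (by omega)]; ring
      omega
    obtain ⟨r, hr, e, he⟩ := ih _ hlt f1 rfl
    refine ⟨r, hr, e + 1, fun φ h1 y h2 => ?_⟩
    have hmap : gt.map φ = g.map φ := by
      ext j
      rw [coeff_map, coeff_map, hgt]
      split_ifs with h
      · rfl
      · rw [map_zero, h1 j (by omega)]
    rw [← he φ h1 y h2, hf1]
    simp only [Polynomial.map_sub, Polynomial.map_mul, map_C, eval_sub, eval_mul, eval_C, hmap, h2]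
    ring

/-- the parameters `x, x'` give the same signs to the elements of `G`. -/
def Agree {A α : Type*} [CommRing A] (ev : α → A →+* ℝ) (G : List A) (x x' : α) : Prop :=
  ∀ a ∈ G, sign (ev x a) = sign (ev x' a)

/-- the one variable polynomials of `F` have the same sign diagram over `x` and `x'`. -/
def Mat {A α : Type*} [CommRing A] (ev : α → A →+* ℝ) (F : List A[X]) (x x' : α) : Prop :=
  ∃ φ : ℝ ≃o ℝ, ∀ f ∈ F, ∀ y,
    sign ((f.map (ev x)).eval y) = sign ((f.map (ev x')).eval (φ y))

theorem mat_step {A α : Type*} [CommRing A] (ev : α → A →+* ℝ) (d : ℕ)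
    (hd : ∀ F : List A[X], (∀ f ∈ F, f.natDegree ≤ d) → ∃ G : List A, ∀ x x',
      Agree ev G x x' → Mat ev F x x') (H : List A[X]) :
    ∀ L : List A[X], (∀ f ∈ L, f.natDegree ≤ d) → (∀ f ∈ H, f.natDegree ≤ d + 1) →
      ∃ G : List A, ∀ x x', Agree ev G x x' → Mat ev (H ++ L) x x' := by
  induction H with
  | nil => intro L hL _; simpa using hd L hL
  | cons f H ih =>
    intro L hL hH
    have hfd : f.natDegree ≤ d + 1 := hH f (by simp)
    choose rem hrem ex hex using fun (g : A[X]) (m : ℕ) => pseudo g m f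
    set Q : List A[X] := derivative f :: (H ++ L) with hQ
    have hder : (derivative f).natDegree ≤ d := by
      have := natDegree_derivative_le f; omega
    have hQd : ∀ g ∈ Q, g.natDegree ≤ d + 1 := by
      intro g hg
      simp only [hQ, List.mem_cons, List.mem_append] at hg
      rcases hg with rfl | hg | hg
      · omega
      · exact hH g (by simp [hg])
      · have := hL g hg; omega
    set R : List A[X] := Q.flatMap (fun g => (List.range (d + 1)).map (fun m => rem g m)) with hR
    have hRmem : ∀ g ∈ Q, ∀ m ≤ d, rem g m ∈ R := by
      intro g hg m hm
      rw [hR, List.mem_flatMap]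
      exact ⟨g, hg, List.mem_map.2 ⟨m, List.mem_range.2 (by omega), rfl⟩⟩
    obtain ⟨G, hG⟩ := ih (derivative f :: (L ++ R)) (by
      intro g hg
      simp only [List.mem_cons, List.mem_append] at hg
      rcases hg with rfl | hg | hg
      · exact hder
      · exact hL g hg
      · rw [hR, List.mem_flatMap] at hg
        obtain ⟨q, -, hq⟩ := hg
        obtain ⟨m, hm, rfl⟩ := List.mem_map.1 hq
        have := List.mem_range.1 hm
        exact (hrem q m).trans (by omega)) (fun g hg => hH g (by simp [hg]))
    refine ⟨G ++ (f :: Q).flatMap (fun g => (List.range (d + 2)).map g.coeff), ?_⟩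
    intro x x' hag
    have hcoef : ∀ g ∈ f :: Q, ∀ j, sign (ev x (g.coeff j)) = sign (ev x' (g.coeff j)) := by
      intro g hg j
      by_cases hj : j < d + 2
      · apply hag
        rw [List.mem_append, List.mem_flatMap]
        exact Or.inr ⟨g, hg, List.mem_map.2 ⟨j, List.mem_range.2 hj, rfl⟩⟩
      · have : g.natDegree ≤ d + 1 := by
          rcases List.mem_cons.1 hg with rfl | h
          · exact hfd
          · exact hQd g h
        rw [coeff_eq_zero_of_natDegree_lt (by omega), (ev x).map_zero, (ev x').map_zero]
    obtain ⟨φ, hφ⟩ := hG x x' (fun a ha => hag a (List.mem_append_left _ ha))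
    have hφQ : ∀ g ∈ Q, ∀ y, sign ((g.map (ev x)).eval y) = sign ((g.map (ev x')).eval (φ y)) := by
      intro g hg
      apply hφ
      simp only [hQ, List.mem_cons, List.mem_append] at hg ⊢
      tauto
    have hcf : ∀ i, sign ((f.map (ev x)).coeff i) = sign ((f.map (ev x')).coeff i) := by
      intro i
      rw [coeff_map, coeff_map]
      exact hcoef f (by simp) i
    by_cases hne : derivative (f.map (ev x)) = 0
    · have hnd := Polynomial.derivative_eq_zero.1 hne
      have hnd' : (f.map (ev x')).natDegree = 0 := by rw [← (lead_data hcf).1, hnd]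
      refine ⟨φ, ?_⟩
      intro g hg
      rw [List.cons_append, List.mem_cons] at hg
      rcases hg with rfl | hg
      · intro y
        rw [eq_C_of_natDegree_eq_zero hnd, eq_C_of_natDegree_eq_zero hnd', eval_C, eval_C]
        exact hcf 0
      · exact hφQ g (by rw [hQ]; exact List.mem_cons_of_mem _ hg)
    · have hZ : {y | ∃ i : {g // g ∈ Q}, (i.1.map (ev x)) ≠ 0 ∧ (i.1.map (ev x)).eval y = 0}.Finite := by
        have : {y | ∃ i : {g // g ∈ Q}, (i.1.map (ev x)) ≠ 0 ∧ (i.1.map (ev x)).eval y = 0} =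
            ⋃ i : {g // g ∈ Q}, {y | (i.1.map (ev x)) ≠ 0 ∧ (i.1.map (ev x)).eval y = 0} := by
          ext y; simp
        rw [this]
        have : Finite {g // g ∈ Q} := Set.Finite.to_subtype (List.finite_toSet Q)
        apply Set.finite_iUnion
        intro i
        by_cases h0 : i.1.map (ev x) = 0
        · simp [h0]
        · exact (Polynomial.finite_setOfPred_isRoot h0).subset (fun y hy => hy.2)
      have hroot : ∀ y ∈ {y | ∃ i : {g // g ∈ Q}, (i.1.map (ev x)) ≠ 0 ∧ (i.1.map (ev x)).eval y = 0},
          sign ((f.map (ev x)).eval y) = sign ((f.map (ev x')).eval (φ y)) := by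
        rintro y ⟨⟨g, hg⟩, h1, h2⟩
        simp only at h1 h2
        have hgc : ∀ i, sign ((g.map (ev x)).coeff i) = sign ((g.map (ev x')).coeff i) := by
          intro i
          rw [coeff_map, coeff_map]
          exact hcoef g (by simp [hg]) i
        obtain ⟨l1, l2⟩ := lead_data hgc
        have hdeg : (g.map (ev x)).natDegree ≠ 0 := by
          intro h0
          rw [eq_C_of_natDegree_eq_zero h0, eval_C] at h2
          apply h1
          rw [eq_C_of_natDegree_eq_zero h0, h2, C_0]
        obtain ⟨m, hm⟩ := Nat.exists_eq_succ_of_ne_zero hdeg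
        have hmd : m ≤ d := by
          have a := natDegree_map_le (f := ev x) (p := g)
          have b := hQd g hg
          omega
        have h2' : (g.map (ev x')).eval (φ y) = 0 := by
          have := hφQ g hg y
          rw [h2, sign_zero, eq_comm, sign_eq_zero_iff] at this
          exact this
        have k1 := hex g m (ev x) (fun j hj => by
          rw [← coeff_map]; exact coeff_eq_zero_of_natDegree_lt (by omega)) y h2
        have k2 := hex g m (ev x') (fun j hj => by
          rw [← coeff_map]; exact coeff_eq_zero_of_natDegree_lt (by omega)) (φ y) h2'
        have hc0 : ev x (g.coeff (m + 1)) ≠ 0 := by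
          rw [← coeff_map]
          have : (g.map (ev x)).leadingCoeff ≠ 0 := leadingCoeff_ne_zero.2 h1
          rw [leadingCoeff, hm] at this
          exact this
        have hr := hφ (rem g m) (by simp [hRmem g hg m hmd]) y
        rw [← k1, ← k2, sign_mul, sign_mul, sign_pow, sign_pow, hcoef g (by simp [hg])] at hr
        have hs : sign (ev x' (g.coeff (m + 1))) ^ ex g m ≠ 0 := by
          apply pow_ne_zero
          rw [← hcoef g (by simp [hg]), Ne, sign_eq_zero_iff]
          exact hc0
        exact mul_left_cancel₀ hs hr
      obtain ⟨ψ, hψ1, hψ2⟩ := core (ι := {g // g ∈ Q}) (P := fun i => i.1.map (ev x))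
        (P' := fun i => i.1.map (ev x')) (f := f.map (ev x)) (k := f.map (ev x'))
        (i0 := ⟨derivative f, by simp [hQ]⟩) (by simp [derivative_map]) (by simp [derivative_map])
        hne hZ hcf _ (φ := φ) (fun i y => hφQ i.1 i.2 y) hroot le_rfl
      refine ⟨ψ, ?_⟩
      intro g hg
      rw [List.cons_append, List.mem_cons] at hg
      rcases hg with rfl | hg
      · exact hψ2
      · exact hψ1 ⟨g, by rw [hQ]; exact List.mem_cons_of_mem _ hg⟩

theorem mat_exists {A α : Type*} [CommRing A] (ev : α → A →+* ℝ) (d : ℕ) :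
    ∀ F : List A[X], (∀ f ∈ F, f.natDegree ≤ d) → ∃ G : List A, ∀ x x',
      Agree ev G x x' → Mat ev F x x' := by
  induction d with
  | zero =>
    intro F hF
    refine ⟨F.map (fun f => f.coeff 0), fun x x' h => ⟨OrderIso.refl ℝ, fun f hf y => ?_⟩⟩
    rw [eq_C_of_natDegree_eq_zero (Nat.le_zero.1 (hF f hf)), map_C, map_C, eval_C, eval_C]
    exact h _ (List.mem_map.2 ⟨f, hf, rfl⟩)
  | succ d ih =>
    intro F hF
    simpa using mat_step ev d ih F [] (by simp) hF

theorem mat_exists' {A α : Type*} [CommRing A] (ev : α → A →+* ℝ) (F : List A[X]) :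
    ∃ G : List A, ∀ x x', Agree ev G x x' → Mat ev F x x' := by
  have hb : ∃ d, ∀ f ∈ F, f.natDegree ≤ d := by
    induction F with
    | nil => exact ⟨0, by simp⟩
    | cons f F ih =>
      obtain ⟨d, hd⟩ := ih
      refine ⟨max d f.natDegree, fun g hg => ?_⟩
      rcases List.mem_cons.1 hg with rfl | h
      · exact le_max_right _ _
      · exact (hd g h).trans (le_max_left _ _)
  obtain ⟨d, hd⟩ := hb
  exact mat_exists ev d F hd

/-- semialgebraic subsets of the parameter space `α` (invariant under a finite sign partition). -/
def SA {A α : Type*} [CommRing A] (ev : α → A →+* ℝ) (S : α → Prop) : Prop :=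
  ∃ G : List A, ∀ x x', Agree ev G x x' → (S x → S x')

theorem Agree.symm {A α : Type*} [CommRing A] {ev : α → A →+* ℝ} {G : List A} {x x' : α}
    (h : Agree ev G x x') : Agree ev G x' x := fun a ha => (h a ha).symm

theorem SA.and {A α : Type*} [CommRing A] {ev : α → A →+* ℝ} {S T : α → Prop}
    (hS : SA ev S) (hT : SA ev T) : SA ev (fun x => S x ∧ T x) := by
  obtain ⟨G, hG⟩ := hS
  obtain ⟨G', hG'⟩ := hT
  refine ⟨G ++ G', fun x x' h hx => ⟨hG x x' (fun a ha => h a (by simp [ha])) hx.1,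
    hG' x x' (fun a ha => h a (by simp [ha])) hx.2⟩⟩

theorem SA.of_sign {A α : Type*} [CommRing A] {ev : α → A →+* ℝ} (a : A) (p : SignType → Prop) :
    SA ev (fun x => p (sign (ev x a))) :=
  ⟨[a], fun x x' h hx => by
    have := h a (by simp)
    simp only at hx ⊢
    rwa [← this]⟩

/-- Tarski-Seidenberg, one variable. -/
theorem SA.proj {A α : Type*} [CommRing A] {ev : α → A →+* ℝ} {S : α × ℝ → Prop}
    (hS : SA (fun z : α × ℝ => (Polynomial.evalRingHom z.2).comp (Polynomial.mapRingHom (ev z.1))) S) :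
    SA ev (fun x => ∃ y, S (x, y)) := by
  obtain ⟨F, hF⟩ := hS
  obtain ⟨G, hG⟩ := mat_exists' ev F
  refine ⟨G, fun x x' h hx => ?_⟩
  obtain ⟨y, hy⟩ := hx
  obtain ⟨φ, hφ⟩ := hG x x' h
  refine ⟨φ y, hF (x, y) (x', φ y) ?_ hy⟩
  intro f hf
  simpa using hφ f hf y

/-- Tarski-Seidenberg. -/
theorem SA.projn {A α : Type*} [CommRing A] {ev : α → A →+* ℝ} (n : ℕ) :
    ∀ {S : α × (Fin n → ℝ) → Prop}, 
    SA (fun z : α × (Fin n → ℝ) => MvPolynomial.eval₂Hom (ev z.1) z.2) S →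
    SA ev (fun x => ∃ y, S (x, y)) := by
  induction n with
  | zero =>
    rintro S ⟨F, hF⟩
    refine ⟨F.map (MvPolynomial.isEmptyAlgEquiv A (Fin 0)), fun x x' h hx => ?_⟩
    obtain ⟨y, hy⟩ := hx
    refine ⟨y, hF (x, y) (x', y) ?_ hy⟩
    intro f hf
    have := h _ (List.mem_map.2 ⟨f, hf, rfl⟩)
    obtain ⟨a, rfl⟩ := (MvPolynomial.isEmptyAlgEquiv A (Fin 0)).symm.surjective f
    rw [AlgEquiv.apply_symm_apply] at this
    simpa using this
  | succ n ih =>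
    rintro S ⟨F, hF⟩
    have h1 : SA (fun z : α × (Fin n → ℝ) => MvPolynomial.eval₂Hom (ev z.1) z.2)
        (fun z => ∃ y : ℝ, (fun w : (α × (Fin n → ℝ)) × ℝ =>
          S (w.1.1, (Fin.cons w.2 w.1.2 : Fin (n+1) → ℝ))) (z, y)) := by
      apply SA.proj (ev := fun z : α × (Fin n → ℝ) => MvPolynomial.eval₂Hom (ev z.1) z.2)
        (S := fun w : (α × (Fin n → ℝ)) × ℝ => S (w.1.1, (Fin.cons w.2 w.1.2 : Fin (n+1) → ℝ)))
      refine ⟨F.map (MvPolynomial.finSuccEquiv A n), fun z z' h => hF _ _ ?_⟩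
      intro f hf
      have := h _ (List.mem_map.2 ⟨f, hf, rfl⟩)
      have key : ∀ z : (α × (Fin n → ℝ)) × ℝ,
          ((Polynomial.evalRingHom z.2).comp (Polynomial.mapRingHom
            (MvPolynomial.eval₂Hom (ev z.1.1) z.1.2))) (MvPolynomial.finSuccEquiv A n f) =
          MvPolynomial.eval₂Hom (ev z.1.1) (Fin.cons z.2 z.1.2 : Fin (n+1) → ℝ) f := by
        intro z
        have hh : ((Polynomial.evalRingHom z.2).comp (Polynomial.mapRingHom
            (MvPolynomial.eval₂Hom (ev z.1.1) z.1.2))).comp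
              (MvPolynomial.finSuccEquiv A n : _ →+* _) =
            MvPolynomial.eval₂Hom (ev z.1.1) (Fin.cons z.2 z.1.2 : Fin (n+1) → ℝ) := by
          apply MvPolynomial.ringHom_ext
          · intro a
            simp [MvPolynomial.finSuccEquiv_apply]
          · intro i
            refine Fin.cases ?_ (fun i => ?_) i
            · simp [MvPolynomial.finSuccEquiv_apply]
            · simp [MvPolynomial.finSuccEquiv_apply]
        exact RingHom.congr_fun hh f
      rw [key, key] at this
      exact this
    obtain ⟨G, hG⟩ := ih h1
    refine ⟨G, fun x x' h hx => ?_⟩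
    obtain ⟨y, hy⟩ := hx
    obtain ⟨s, t, hs⟩ := hG x x' h ⟨Fin.tail y, y 0, by simpa using hy⟩
    exact ⟨_, hs⟩


theorem continuous_evalEval (q : ℝ[X][X]) : Continuous fun z : ℝ × ℝ => evalEval z.1 z.2 q := by
  induction q using Polynomial.induction_on' with
  | add p q hp hq => simp only [evalEval_add]; exact hp.add hq
  | monomial n a =>
    have : (fun z : ℝ × ℝ => evalEval z.1 z.2 (monomial n a)) =
        fun z => a.eval z.1 * z.2 ^ n := by
      funext z
      simp [evalEval, eval_monomial]
    rw [this]
    exact (a.continuous.comp continuous_fst).mul (continuous_snd.pow n)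

theorem sign_small (P : ℝ[X][X]) : ∃ N : ℕ, ∃ δ₀ : ℝ, 0 < δ₀ ∧ δ₀ ≤ 1 ∧ ∃ σ : SignType,
    ∀ δ s : ℝ, 0 < δ → δ < δ₀ → 0 < s → s < δ ^ N → sign (evalEval δ s P) = σ := by
  classical
  induction P using Polynomial.recOnHorner with
  | M0 => exact ⟨0, 1, one_pos, le_rfl, 0, by simp⟩
  | MX p _ ih =>
    obtain ⟨N, δ₀, h0, h1, σ, h⟩ := ih
    refine ⟨N, δ₀, h0, h1, σ, fun δ s a b c d => ?_⟩
    rw [evalEval_mul, sign_mul, h δ s a b c d, evalEval_X, sign_pos c, mul_one]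
  | MC p a hp ha _ =>
    obtain ⟨q, rfl⟩ := X_dvd_iff.2 hp
    obtain ⟨u, hu, hdvd⟩ := exists_eq_pow_rootMultiplicity_mul_and_not_dvd a ha 0
    set j := a.rootMultiplicity 0
    have hu0 : u.eval 0 ≠ 0 := by
      intro h; exact hdvd (dvd_iff_isRoot.2 h)
    have hc : Continuous fun z : ℝ × ℝ => u.eval z.1 + z.2 * evalEval z.1 (z.2 * z.1 ^ j) q := by
      refine (u.continuous.comp continuous_fst).add (continuous_snd.mul ?_)
      exact (continuous_evalEval q).comp
        (continuous_fst.prodMk (continuous_snd.mul (continuous_fst.pow j)))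
    have hev : ∀ᶠ z : ℝ × ℝ in 𝓝 (0, 0),
        sign (u.eval z.1 + z.2 * evalEval z.1 (z.2 * z.1 ^ j) q) = sign (u.eval 0) := by
      have ht := hc.tendsto ((0 : ℝ), (0 : ℝ))
      simp only [zero_mul, add_zero] at ht
      rcases lt_or_gt_of_ne hu0 with h | h
      · filter_upwards [ht.eventually (gt_mem_nhds h)] with z hz
        rw [sign_neg hz, sign_neg h]
      · filter_upwards [ht.eventually (lt_mem_nhds h)] with z hz
        rw [sign_pos hz, sign_pos h]
    obtain ⟨ε, hε, hball⟩ := Metric.eventually_nhds_iff.1 hev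
    refine ⟨j + 1, min ε 1, lt_min hε one_pos, min_le_right _ _, sign (u.eval 0), ?_⟩
    intro δ s hδ hδ0 hs hsN
    have hδε : δ < ε := lt_of_lt_of_le hδ0 (min_le_left _ _)
    have hpj : 0 < δ ^ j := pow_pos hδ j
    have ht0 : 0 < s / δ ^ j := div_pos hs hpj
    have ht : s / δ ^ j < δ := by
      rw [div_lt_iff₀ hpj]; rwa [pow_succ'] at hsN
    have := @hball (δ, s / δ ^ j) (by
      rw [Prod.dist_eq, Real.dist_eq, Real.dist_eq]
      simp only [sub_zero]
      rw [abs_of_pos hδ, abs_of_pos ht0]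
      exact max_lt hδε (ht.trans hδε))
    simp only [div_mul_cancel₀ s hpj.ne'] at this
    have key : evalEval δ s (X * q + C a) = δ ^ j * (u.eval δ + s / δ ^ j * evalEval δ s q) := by
      rw [evalEval_add, evalEval_mul, evalEval_X, evalEval_C, hu]
      simp only [eval_mul, eval_pow, eval_sub, eval_X, eval_C, sub_zero]
      rw [mul_add, ← mul_assoc, mul_div_cancel₀ s hpj.ne']
      ring
    rw [key, sign_mul, sign_pos hpj, one_mul, this]

/-- evaluation of two-variable polynomials -/
noncomputable def ev2 (z : ℝ × ℝ) : ℝ[X][X] →+* ℝ := evalEvalRingHom z.1 z.2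

theorem agree_small (G : List ℝ[X][X]) : ∃ N : ℕ, ∃ δ₀ : ℝ, 0 < δ₀ ∧ δ₀ ≤ 1 ∧
    ∀ δ s s' : ℝ, 0 < δ → δ < δ₀ → 0 < s → s < δ ^ N → 0 < s' → s' < δ ^ N →
      Agree ev2 G (δ, s) (δ, s') := by
  induction G with
  | nil => exact ⟨0, 1, one_pos, le_rfl, fun _ _ _ _ _ _ _ _ _ a ha => by simp at ha⟩
  | cons P G ih =>
    obtain ⟨N, δ₀, h0, h1, h⟩ := ih
    obtain ⟨N', δ₀', h0', h1', σ, h'⟩ := sign_small P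
    refine ⟨N + N', min δ₀ δ₀', lt_min h0 h0', (min_le_left _ _).trans h1, ?_⟩
    intro δ s s' hδ hlt hs hsN hs' hsN'
    have l1 : δ < δ₀ := hlt.trans_le (min_le_left _ _)
    have l2 : δ < δ₀' := hlt.trans_le (min_le_right _ _)
    have hle : δ ≤ 1 := (l1.trans_le h1).le
    have p1 : δ ^ (N + N') ≤ δ ^ N := pow_le_pow_of_le_one hδ.le hle (by omega)
    have p2 : δ ^ (N + N') ≤ δ ^ N' := pow_le_pow_of_le_one hδ.le hle (by omega)
    intro a ha
    rcases List.mem_cons.1 ha with rfl | ha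
    · exact (h' δ s hδ l2 hs (hsN.trans_le p2)).trans (h' δ s' hδ l2 hs' (hsN'.trans_le p2)).symm
    · exact h δ s s' hδ l1 hs (hsN.trans_le p1) hs' (hsN'.trans_le p1) a ha

theorem small {E : ℝ × ℝ → Prop} (hE : SA ev2 E)
    (h : ∀ δ > 0, ∃ s₀ > 0, ∀ s, 0 < s → s < s₀ → ¬ E (δ, s)) :
    ∃ N : ℕ, ∃ δ₀ : ℝ, 0 < δ₀ ∧ δ₀ ≤ 1 ∧
      ∀ δ s : ℝ, 0 < δ → δ < δ₀ → 0 < s → s < δ ^ N → ¬ E (δ, s) := by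
  obtain ⟨G, hG⟩ := hE
  obtain ⟨N, δ₀, h0, h1, hA⟩ := agree_small G
  refine ⟨N, δ₀, h0, h1, ?_⟩
  intro δ s hδ hlt hs hsN hEs
  obtain ⟨s₀, hs₀, hn⟩ := h δ hδ
  have hp : 0 < δ ^ N := pow_pos hδ N
  have hm : 0 < min s₀ (δ ^ N) := lt_min hs₀ hp
  have m1 := min_le_left s₀ (δ ^ N)
  have m2 := min_le_right s₀ (δ ^ N)
  refine hn (min s₀ (δ ^ N) / 2) (by linarith) (by linarith) ?_
  exact hG _ _ (hA δ s _ hδ hlt hs hsN (by linarith) (by linarith)) hEs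

theorem SA.eq0 {A α : Type*} [CommRing A] {ev : α → A →+* ℝ} (a : A) :
    SA ev (fun x => ev x a = 0) := by
  simpa only [sign_eq_zero_iff] using SA.of_sign (ev := ev) a (fun s => s = 0)

theorem SA.ne0 {A α : Type*} [CommRing A] {ev : α → A →+* ℝ} (a : A) :
    SA ev (fun x => ev x a ≠ 0) := by
  simpa only [ne_eq, sign_eq_zero_iff] using SA.of_sign (ev := ev) a (fun s => s ≠ 0)

theorem SA.nn {A α : Type*} [CommRing A] {ev : α → A →+* ℝ} (a : A) :
    SA ev (fun x => 0 ≤ ev x a) := by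
  simpa only [sign_nonneg_iff] using SA.of_sign (ev := ev) a (fun s => 0 ≤ s)

theorem sa_E {n : ℕ} (w b r0 r1 h m : MvPolynomial (Fin n) ℝ) :
    SA ev2 (fun z => ∃ x : Fin n → ℝ, MvPolynomial.eval x w = 0 ∧ MvPolynomial.eval x b ≠ 0 ∧
      0 ≤ - (MvPolynomial.eval x r1 * MvPolynomial.eval x r0) ∧
      0 ≤ 1 - z.1 * MvPolynomial.eval x m ∧ 0 ≤ MvPolynomial.eval x h ^ 2 - z.1 ∧
      0 ≤ z.2 - MvPolynomial.eval x r0 ^ 2) := by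
  let ι : MvPolynomial (Fin n) ℝ →+* MvPolynomial (Fin n) ℝ[X][X] :=
    MvPolynomial.map ((C : ℝ[X] →+* ℝ[X][X]).comp C)
  let D : MvPolynomial (Fin n) ℝ[X][X] := MvPolynomial.C (C X)
  let T : MvPolynomial (Fin n) ℝ[X][X] := MvPolynomial.C X
  let ev : (ℝ × ℝ) × (Fin n → ℝ) → MvPolynomial (Fin n) ℝ[X][X] →+* ℝ :=
    fun z => MvPolynomial.eval₂Hom (ev2 z.1) z.2
  have e1 : ∀ z p, ev z (ι p) = MvPolynomial.eval z.2 p := by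
    intro z p
    have : (ev z).comp ι = MvPolynomial.eval z.2 := by
      apply MvPolynomial.ringHom_ext
      · intro a; simp [ev, ι, ev2]
      · intro i; simp [ev, ι]
    rw [← this]; rfl
  have e2 : ∀ z, ev z D = z.1.1 := by intro z; simp [ev, D, ev2]
  have e3 : ∀ z, ev z T = z.1.2 := by intro z; simp [ev, T, ev2]
  have := (SA.eq0 (ev := ev) (ι w)).and ((SA.ne0 (ev := ev) (ι b)).and
    ((SA.nn (ev := ev) (-(ι r1 * ι r0))).and ((SA.nn (ev := ev) (1 - D * ι m)).and
    ((SA.nn (ev := ev) (ι h ^ 2 - D)).and (SA.nn (ev := ev) (T - ι r0 ^ 2))))))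
  simp only [map_neg, map_mul, map_sub, map_pow, map_one, e1, e2, e3] at this
  exact SA.projn n this

/-- Lojasiewicz type inequality. -/
theorem loja {n : ℕ} (w b r0 r1 h m : MvPolynomial (Fin n) ℝ)
    (hm : m = ∑ i, MvPolynomial.X i ^ 2) (g : (Fin n → ℝ) → ℝ) (hg : Continuous g)
    (hgr : ∀ x, MvPolynomial.eval x w = 0 →
      MvPolynomial.eval x r0 = g x * MvPolynomial.eval x b ^ 2)
    (hgh : ∀ x, MvPolynomial.eval x w = 0 → (g x = 0 ↔ MvPolynomial.eval x h = 0))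
    (hr1 : ∀ x, MvPolynomial.eval x w = 0 → MvPolynomial.eval x b = 0 → g x ≠ 0 →
      0 < g x * MvPolynomial.eval x r1) :
    ∃ N : ℕ, N ≠ 0 ∧ ∃ c : ℝ, 0 < c ∧ ∀ x, MvPolynomial.eval x w = 0 → MvPolynomial.eval x b ≠ 0 →
      MvPolynomial.eval x r1 * MvPolynomial.eval x r0 ≤ 0 →  MvPolynomial.eval x h ≠ 0 →
      c ^ N * MvPolynomial.eval x h ^ (2 * N) ≤ MvPolynomial.eval x r0 ^ 2 *
        ((1 + MvPolynomial.eval x h ^ 2) * (1 + MvPolynomial.eval x m)) ^ N := by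
  have hmx : ∀ x, MvPolynomial.eval x m = ∑ i, x i ^ 2 := by intro x; simp [hm]
  have hm0 : ∀ x, 0 ≤ MvPolynomial.eval x m := by
    intro x; rw [hmx]; exact Finset.sum_nonneg fun i _ => sq_nonneg _
  obtain ⟨N, δ₀, h0, h1, hN⟩ := small (sa_E w b r0 r1 h m) (by
    intro δ hδ
    let K : Set (Fin n → ℝ) := {x | MvPolynomial.eval x w = 0 ∧ δ * MvPolynomial.eval x m ≤ 1 ∧
      δ ≤ MvPolynomial.eval x h ^ 2 ∧ MvPolynomial.eval x r1 * g x ≤ 0}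
    have hcl : IsClosed K := by
      refine IsClosed.and ?_ (IsClosed.and ?_ (IsClosed.and ?_ ?_))
      · exact isClosed_eq (MvPolynomial.continuous_eval w) continuous_const
      · exact isClosed_le (continuous_const.mul (MvPolynomial.continuous_eval m)) continuous_const
      · exact isClosed_le continuous_const ((MvPolynomial.continuous_eval h).pow 2)
      · exact isClosed_le ((MvPolynomial.continuous_eval r1).mul hg) continuous_const
    have hbd : Bornology.IsBounded K := by
      refine (Metric.isBounded_closedBall (x := (0 : Fin n → ℝ)) (r := 1 + 1 / δ)).subset ?_
      intro x hx
      rw [mem_closedBall_zero_iff, pi_norm_le_iff_of_nonneg (by positivity)]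
      intro i
      have a1 : x i ^ 2 ≤ 1 / δ := by
        rw [le_div_iff₀ hδ]
        have := Finset.single_le_sum (f := fun i => x i ^ 2) (fun i _ => sq_nonneg _)
          (Finset.mem_univ i)
        rw [← hmx] at this
        have h2 := hx.2.1
        nlinarith
      rw [Real.norm_eq_abs]
      have : 0 < 1 / δ := by positivity
      apply abs_le_of_sq_le_sq _ (by positivity)
      nlinarith
    have hK : IsCompact K := Metric.isCompact_of_isClosed_isBounded hcl hbd
    have hpos : ∀ x ∈ K, 0 < MvPolynomial.eval x r0 ^ 2 := by
      rintro x ⟨k1, k2, k3, k4⟩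
      have hh : MvPolynomial.eval x h ≠ 0 := by
        intro h; rw [h] at k3; norm_num at k3; linarith
      have hgx : g x ≠ 0 := fun h => hh ((hgh x k1).1 h)
      have hb : MvPolynomial.eval x b ≠ 0 := by
        intro hb
        have := hr1 x k1 hb hgx
        linarith [mul_comm (g x) (MvPolynomial.eval x r1)]
      have : MvPolynomial.eval x r0 ≠ 0 := by
        rw [hgr x k1]; exact mul_ne_zero hgx (pow_ne_zero _ hb)
      positivity
    have hmin : ∃ s₀ > 0, ∀ x ∈ K, s₀ ≤ MvPolynomial.eval x r0 ^ 2 := by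
      by_cases hne : K.Nonempty
      · obtain ⟨x, hx, hmin⟩ := hK.exists_isMinOn hne
          ((MvPolynomial.continuous_eval r0).pow 2).continuousOn
        exact ⟨_, hpos x hx, fun y hy => hmin hy⟩
      · exact ⟨1, one_pos, fun x hx => (hne ⟨x, hx⟩).elim⟩
    obtain ⟨s₀, hs₀, hle⟩ := hmin
    refine ⟨s₀, hs₀, ?_⟩
    rintro s hs hlt ⟨x, x1, x2, x3, x4, x5, x6⟩
    simp only at x4 x5 x6
    have hxK : x ∈ K := by
      refine ⟨x1, by linarith, by linarith, ?_⟩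
      rw [hgr x x1] at x3
      have : 0 < MvPolynomial.eval x b ^ 2 := by positivity
      by_contra hc
      push Not at hc
      nlinarith [mul_pos hc this]
    have := hle x hxK
    linarith)
  refine ⟨N + 1, by omega, δ₀ / 2, by positivity, ?_⟩
  intro x x1 x2 x3 x4
  set H := MvPolynomial.eval x h ^ 2 with hH
  set M := MvPolynomial.eval x m with hM
  have hHp : 0 < H := by positivity
  have hMp : 0 ≤ M := hm0 x
  set D := (1 + H) * (1 + M) with hD
  have hD1 : H ≤ D := by rw [hD]; nlinarith
  have hD2 : M ≤ D := by rw [hD]; nlinarith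
  have hD3 : 1 ≤ D := by rw [hD]; nlinarith
  have hDp : 0 < D := by linarith
  have hgx : g x ≠ 0 := fun h => x4 ((hgh x x1).1 h)
  have hr0 : MvPolynomial.eval x r0 ≠ 0 := by
    rw [hgr x x1]; exact mul_ne_zero hgx (pow_ne_zero _ x2)
  set δ := δ₀ / 2 * H / D with hδ
  have hδp : 0 < δ := by positivity
  have hδD : δ * D = δ₀ / 2 * H := by rw [hδ]; field_simp
  have hδlt : δ < δ₀ := by
    rw [hδ, div_lt_iff₀ hDp]; nlinarith
  have hge : δ ^ N ≤ MvPolynomial.eval x r0 ^ 2 := by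
    by_contra hc
    push Not at hc
    refine hN δ (MvPolynomial.eval x r0 ^ 2) hδp hδlt (by positivity) hc ⟨x, x1, x2, by linarith,
      ?_, ?_, by simp⟩
    · simp only
      rw [← hM]
      have : δ * M ≤ 1 := by
        have : δ * M * (1 + H) ≤ 1 * (1 + H) := by
          have e : δ * (1 + H) * (1 + M) = δ₀ / 2 * H := by rw [← hδD, hD]; ring
          nlinarith
        exact le_of_mul_le_mul_right this (by linarith)
      linarith
    · simp only
      rw [← hH]
      have : δ ≤ H := by
        rw [hδ, div_le_iff₀ hDp]; nlinarith
      linarith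
  have hδ1 : δ ≤ 1 := by linarith
  have hge' : δ ^ (N + 1) ≤ MvPolynomial.eval x r0 ^ 2 :=
    (pow_le_pow_of_le_one hδp.le hδ1 (by omega)).trans hge
  calc (δ₀ / 2) ^ (N + 1) * MvPolynomial.eval x h ^ (2 * (N + 1))
      = δ ^ (N + 1) * D ^ (N + 1) := by
        rw [← mul_pow, hδD, mul_pow, hH, pow_mul]
    _ ≤ _ := mul_le_mul_of_nonneg_right hge' (by positivity)


theorem coeff_eq_limit (k : ℕ) : ∀ (P : ℝ[X]) (H : ℝ → ℝ), Continuous H →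
    (∀ t, P.eval t = t ^ k * H t) → P.coeff k = H 0 := by
  induction k with
  | zero =>
    intro P H _ h
    rw [coeff_zero_eq_eval_zero, h]; simp
  | succ k ih =>
    intro P H hH h
    obtain ⟨Q, rfl⟩ : X ∣ P := by
      rw [X_dvd_iff, coeff_zero_eq_eval_zero, h]; simp
    rw [coeff_X_mul]
    apply ih Q H hH
    have : (fun t => Q.eval t) = fun t => t ^ k * H t := by
      apply Continuous.ext_on (dense_compl_singleton (0 : ℝ)) Q.continuous
        ((continuous_pow k).mul hH)
      intro t ht
      have := h t
      simp only [eval_mul, eval_X] at this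
      have ht' : t ≠ 0 := ht
      apply mul_left_cancel₀ ht'
      show t * Polynomial.eval t Q = t * (t ^ k * H t)
      rw [this]; ring
    exact fun t => congr_fun this t

/-- restriction of a polynomial to lines with direction `v`. -/
noncomputable def ln {n : ℕ} (v : Fin n → ℝ) :
    MvPolynomial (Fin n) ℝ →+* (MvPolynomial (Fin n) ℝ)[X] :=
  MvPolynomial.eval₂Hom ((C : MvPolynomial (Fin n) ℝ →+* _).comp MvPolynomial.C)
    (fun i => C (MvPolynomial.X i) + X * C (MvPolynomial.C (v i)))

theorem ln_eval {n : ℕ} (v x : Fin n → ℝ) (f : MvPolynomial (Fin n) ℝ) (t : ℝ) :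
    ((ln v f).map (MvPolynomial.eval x)).eval t = MvPolynomial.eval (fun i => x i + t * v i) f := by
  have : ((evalRingHom t).comp (mapRingHom (MvPolynomial.eval x))).comp (ln v) =
      MvPolynomial.eval (fun i => x i + t * v i) := by
    apply MvPolynomial.ringHom_ext
    · intro a; simp [ln]
    · intro i; simp [ln]; ring
  rw [← this]; rfl

theorem mul_eq_of_regulous {n : ℕ} {g : (Fin n → ℝ) → ℝ} (hg : Continuous g)
    {p q P : MvPolynomial (Fin n) ℝ} {u : Fin n → ℝ} (hu : MvPolynomial.eval u P ≠ 0)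
    (h : ∀ x, MvPolynomial.eval x P ≠ 0 → g x * MvPolynomial.eval x q = MvPolynomial.eval x p) :
    ∀ x, g x * MvPolynomial.eval x q = MvPolynomial.eval x p := by
  intro x
  set R := (ln (u - x) P).map (MvPolynomial.eval x) with hR
  have hR0 : R ≠ 0 := by
    intro h0
    have := ln_eval (u - x) x P 1
    rw [← hR, h0] at this
    simp at this
    exact hu this.symm
  have hev : ∀ᶠ t in 𝓝[≠] (0:ℝ), ¬ R.IsRoot t :=
    (nhdsNE_le_cofinite (0:ℝ)) (eventually_cofinite_not_isRoot hR0)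
  have hl : Continuous fun t : ℝ => fun i => x i + t * (u - x) i := by fun_prop
  have h1 : Tendsto (fun t : ℝ => g (fun i => x i + t * (u - x) i) *
      MvPolynomial.eval (fun i => x i + t * (u - x) i) q) (𝓝[≠] 0)
      (𝓝 (g x * MvPolynomial.eval x q)) := by
    have := (((hg.comp hl).mul ((MvPolynomial.continuous_eval q).comp hl)).tendsto' 0
      (g x * MvPolynomial.eval x q) (by simp))
    exact this.mono_left nhdsWithin_le_nhds
  have h2 : Tendsto (fun t : ℝ => MvPolynomial.eval (fun i => x i + t * (u - x) i) p) (𝓝[≠] 0)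
      (𝓝 (MvPolynomial.eval x p)) := by
    have := (((MvPolynomial.continuous_eval p).comp hl).tendsto' 0
      (MvPolynomial.eval x p) (by simp))
    exact this.mono_left nhdsWithin_le_nhds
  refine tendsto_nhds_unique (h1.congr' ?_) h2
  filter_upwards [hev] with t ht
  apply h
  intro h0
  apply ht
  rw [IsRoot, hR, ln_eval]
  exact h0

/-- restriction of a regulous function is generically rational. -/
theorem generic_rational {n : ℕ} {g : (Fin n → ℝ) → ℝ} (hg : Continuous g)
    {p q : MvPolynomial (Fin n) ℝ} {u : Fin n → ℝ} (hu : MvPolynomial.eval u q ≠ 0)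
    (h : ∀ x, g x * MvPolynomial.eval x q = MvPolynomial.eval x p)
    {V : Set (Fin n → ℝ)} (hV : V.Nonempty) :
    ∃ a b : MvPolynomial (Fin n) ℝ,
      (∀ x ∈ V, g x * MvPolynomial.eval x b = MvPolynomial.eval x a) ∧
      ∃ x ∈ V, MvPolynomial.eval x b ≠ 0 := by
  classical
  obtain ⟨x0, hx0⟩ := hV
  set v := u - x0 with hv
  have hex : ∃ k, ∃ x ∈ V, MvPolynomial.eval x ((ln v q).coeff k) ≠ 0 := by
    by_contra hc
    push Not at hc
    have : (ln v q).map (MvPolynomial.eval x0) = 0 := by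
      ext k; rw [coeff_map, hc k x0 hx0, coeff_zero]
    have h1 := ln_eval v x0 q 1
    rw [this] at h1
    simp [hv] at h1
    exact hu h1.symm
  refine ⟨(ln v p).coeff (Nat.find hex), (ln v q).coeff (Nat.find hex), ?_, Nat.find_spec hex⟩
  set k := Nat.find hex with hk
  intro x hx
  have hdvd : X ^ k ∣ (ln v q).map (MvPolynomial.eval x) := by
    rw [X_pow_dvd_iff]
    intro d hd
    rw [coeff_map]
    by_contra hne
    exact Nat.find_min hex hd ⟨x, hx, hne⟩
  obtain ⟨Q, hQ⟩ := hdvd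
  have hl : Continuous fun t : ℝ => fun i => x i + t * v i := by fun_prop
  have := coeff_eq_limit k ((ln v p).map (MvPolynomial.eval x))
    (fun t => g (fun i => x i + t * v i) * Q.eval t) ((hg.comp hl).mul Q.continuous) (by
      intro t
      rw [ln_eval, ← h, ← ln_eval, hQ]
      simp only [eval_mul, eval_pow, eval_X]
      ring)
  rw [coeff_map] at this
  rw [this]
  simp only [zero_mul, add_zero]
  congr 1
  rw [← coeff_map, hQ, coeff_X_pow_mul', if_pos le_rfl, Nat.sub_self, coeff_zero_eq_eval_zero]

theorem glue {n : ℕ} (w a b r1 h : MvPolynomial (Fin n) ℝ) (g : (Fin n → ℝ) → ℝ)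
    (hg : Continuous g)
    (hab : ∀ x, MvPolynomial.eval x w = 0 →
      g x * MvPolynomial.eval x b = MvPolynomial.eval x a)
    (hgh : ∀ x, MvPolynomial.eval x w = 0 → (g x = 0 ↔ MvPolynomial.eval x h = 0))
    (hr1 : ∀ x, MvPolynomial.eval x w = 0 → MvPolynomial.eval x b = 0 →
      sign (g x) = sign (MvPolynomial.eval x r1)) :
    ∃ p : MvPolynomial (Fin n) ℝ, ∀ x, MvPolynomial.eval x w = 0 →
      sign (g x) = sign (MvPolynomial.eval x p) := by
  obtain ⟨N, hN, c, hc, hL⟩ := loja w b (a * b) r1 h (∑ i, MvPolynomial.X i ^ 2) rfl g hg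
    (by intro x hx; rw [map_mul, ← hab x hx]; ring) hgh (by
      intro x hx hb hne
      have := hr1 x hx hb
      rcases lt_or_gt_of_ne hne with h1 | h1
      · rw [sign_neg h1, eq_comm, sign_eq_neg_one_iff] at this
        exact mul_pos_of_neg_of_neg h1 this
      · rw [sign_pos h1, eq_comm, sign_eq_one_iff] at this
        exact mul_pos h1 this)
  set m : MvPolynomial (Fin n) ℝ := ∑ i, MvPolynomial.X i ^ 2 with hm
  refine ⟨r1 * (MvPolynomial.C (c ^ N) * h ^ (2 * N)) +
    (a * b) * ((1 + (a * b) ^ 2) * ((1 + h ^ 2) * (1 + m)) ^ N * (1 + r1 ^ 2)), ?_⟩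
  intro x hx
  have hLx := hL x hx
  have hmx : 0 ≤ MvPolynomial.eval x m := by
    simp only [hm, map_sum, map_pow, MvPolynomial.eval_X]
    exact Finset.sum_nonneg fun i _ => sq_nonneg _
  have habx := hab x hx
  have hghx := hgh x hx
  have hr1x := hr1 x hx
  simp only [map_add, map_mul, map_pow, map_one, MvPolynomial.eval_C] at hLx ⊢
  set A := MvPolynomial.eval x a
  set B := MvPolynomial.eval x b
  set H := MvPolynomial.eval x h
  set R := MvPolynomial.eval x r1
  set M := MvPolynomial.eval x m
  set D := ((1 + H ^ 2) * (1 + M)) ^ N with hD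
  have hDp : 0 < D := by positivity
  by_cases hH : H = 0
  · have hg0 := hghx.2 hH
    rw [hg0, zero_mul] at habx
    rw [hg0, ← habx, hH]
    simp [hN]
  have hg0 : g x ≠ 0 := fun h => hH (hghx.1 h)
  set U := c ^ N * H ^ (2 * N) with hU
  have hUp : 0 < U := by
    rw [hU, pow_mul]; positivity
  by_cases hB : B = 0
  · rw [hr1x hB, hB, mul_zero, zero_mul, add_zero, sign_mul, sign_pos hUp, mul_one]
  have hr0 : A * B = g x * B ^ 2 := by rw [← habx]; ring
  have hB2 : 0 < B ^ 2 := by positivity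
  have hsg : sign (g x) = sign (A * B) := by rw [hr0, sign_mul, sign_pos hB2, mul_one]
  have hr0ne : A * B ≠ 0 := by rw [hr0]; exact mul_ne_zero hg0 hB2.ne'
  rw [hsg]
  set r := A * B
  set W := (1 + r ^ 2) * D * (1 + R ^ 2) with hW
  have hWp : 0 < W := by positivity
  by_cases hneg : R * r ≤ 0
  · have hl := hLx hB hneg hH
    have hR2 : |R| < 1 + R ^ 2 := by
      rcases abs_cases R with ⟨h1, _⟩ | ⟨h1, _⟩ <;> rw [h1] <;> nlinarith [sq_nonneg (R - 1), sq_nonneg (R + 1), sq_nonneg R]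
    have har : r ^ 2 ≤ |r| * (1 + r ^ 2) := by
      have e : r ^ 2 = |r| ^ 2 := (sq_abs r).symm
      rw [e]
      have := abs_nonneg r
      nlinarith [mul_nonneg this (sq_nonneg (|r| - 1)), mul_nonneg this (sq_nonneg (|r|))]
    have hbig : |R| * U < |r| * W := by
      calc |R| * U < (1 + R ^ 2) * U := mul_lt_mul_of_pos_right hR2 hUp
        _ ≤ (1 + R ^ 2) * (r ^ 2 * D) := mul_le_mul_of_nonneg_left hl (by positivity)
        _ ≤ (1 + R ^ 2) * ((|r| * (1 + r ^ 2)) * D) := by gcongr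
        _ = |r| * W := by rw [hW]; ring
    have hRU : |R * U| < |r * W| := by
      rw [abs_mul R U, abs_mul r W, abs_of_pos hUp, abs_of_pos hWp]; exact hbig
    rcases lt_or_gt_of_ne hr0ne with h1 | h1
    · have h2 : r * W < 0 := mul_neg_of_neg_of_pos h1 hWp
      rw [abs_of_neg h2] at hRU
      have := (abs_lt.1 hRU).2
      rw [sign_neg h1, sign_neg (by linarith)]
    · have h2 : 0 < r * W := mul_pos h1 hWp
      rw [abs_of_pos h2] at hRU
      have := (abs_lt.1 hRU).1
      rw [sign_pos h1, sign_pos (by linarith)]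
  · push Not at hneg
    rcases lt_or_gt_of_ne hr0ne with h1 | h1
    · have hR : R < 0 := by
        by_contra hc; push Not at hc; nlinarith
      rw [sign_neg h1, sign_neg (by nlinarith [mul_neg_of_neg_of_pos h1 hWp, mul_neg_of_neg_of_pos hR hUp])]
    · have hR : 0 < R := by
        by_contra hc; push Not at hc; nlinarith
      rw [sign_pos h1, sign_pos (by nlinarith [mul_pos h1 hWp, mul_pos hR hUp])]

theorem sumsq {n : ℕ} {ι : Type*} (s : Finset ι) (P : ι → MvPolynomial (Fin n) ℝ) (x : Fin n → ℝ) :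
    MvPolynomial.eval x (∑ i ∈ s, P i ^ 2) = 0 ↔ ∀ i ∈ s, MvPolynomial.eval x (P i) = 0 := by
  rw [map_sum, Finset.sum_eq_zero_iff_of_nonneg (by intro i _; rw [map_pow]; positivity)]
  simp

theorem main {n : ℕ} (w h p q : MvPolynomial (Fin n) ℝ) (g : (Fin n → ℝ) → ℝ)
    (hg : Continuous g) (u : Fin n → ℝ) (hu : MvPolynomial.eval u q ≠ 0)
    (hpq : ∀ x, g x * MvPolynomial.eval x q = MvPolynomial.eval x p)
    (hgh : ∀ x, MvPolynomial.eval x w = 0 → (g x = 0 ↔ MvPolynomial.eval x h = 0))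
    (J : Ideal (MvPolynomial (Fin n) ℝ)) :
    ∃ r : MvPolynomial (Fin n) ℝ, ∀ x, MvPolynomial.eval x w = 0 →
      (∀ f ∈ J, MvPolynomial.eval x f = 0) → sign (g x) = sign (MvPolynomial.eval x r) := by
  induction J using WellFoundedGT.induction with
  | ind J ih =>
    by_cases hV : {x | MvPolynomial.eval x w = 0 ∧ ∀ f ∈ J, MvPolynomial.eval x f = 0}.Nonempty
    swap
    · exact ⟨0, fun x h1 h2 => (hV ⟨x, h1, h2⟩).elim⟩
    obtain ⟨a, b, hab, y, hy, hby⟩ := generic_rational hg hu hpq hV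
    have hbJ : b ∉ J := fun hb => hby (hy.2 b hb)
    obtain ⟨r1, hr1⟩ := ih (J ⊔ Ideal.span {b}) (by
      refine lt_of_le_of_ne le_sup_left ?_
      intro he
      apply hbJ
      rw [he]
      exact Ideal.mem_sup_right (Ideal.mem_span_singleton_self b))
    obtain ⟨s, hs⟩ := IsNoetherian.noetherian J
    have hW : ∀ x, MvPolynomial.eval x (w ^ 2 + ∑ f ∈ s, f ^ 2) = 0 ↔
        (MvPolynomial.eval x w = 0 ∧ ∀ f ∈ J, MvPolynomial.eval x f = 0) := by
      intro x
      have hnn : 0 ≤ MvPolynomial.eval x (∑ f ∈ s, f ^ 2) := by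
        rw [map_sum]; exact Finset.sum_nonneg fun i _ => by rw [map_pow]; positivity
      rw [map_add, add_eq_zero_iff_of_nonneg (by rw [map_pow]; positivity) hnn, sumsq, map_pow,
        pow_eq_zero_iff two_ne_zero]
      refine and_congr_right fun _ => ⟨fun hh f hf => ?_, fun hh f hf => hh f ?_⟩
      · have : J ≤ RingHom.ker (MvPolynomial.eval x) := by
          rw [← hs]
          exact Submodule.span_le.2 fun f hf => hh f hf
        exact this hf
      · rw [← hs]; exact Submodule.subset_span hf
    obtain ⟨r, hr⟩ := glue (w ^ 2 + ∑ f ∈ s, f ^ 2) a b r1 h g hg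
      (fun x hx => hab x ((hW x).1 hx)) (fun x hx => hgh x ((hW x).1 hx).1)
      (fun x hx hb => hr1 x ((hW x).1 hx).1 (by
        have : J ⊔ Ideal.span {b} ≤ RingHom.ker (MvPolynomial.eval x) := by
          refine sup_le (fun f hf => ((hW x).1 hx).2 f hf) ?_
          rw [Ideal.span_le]
          simpa using hb
        exact fun f hf => this hf))
    exact ⟨r, fun x h1 h2 => hr x ((hW x).2 ⟨h1, h2⟩)⟩

end RegAux

end RegAuxSection

open MvPolynomial Set

/-- A real algebraic set: the common zero locus of finitely many real polynomials. -/
def IsRealAlgebraicSet {n : ℕ} (X : Set (Fin n → ℝ)) : Prop :=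
  ∃ (k : ℕ) (p : Fin k → MvPolynomial (Fin n) ℝ),
    X = {x | ∀ i, MvPolynomial.eval x (p i) = 0}

/-- `V` is a real algebraic subset of `X`, i.e. a Zariski closed subset of `X`. -/
def IsZariskiClosedIn {n : ℕ} (X V : Set (Fin n → ℝ)) : Prop :=
  IsRealAlgebraicSet V ∧ V ⊆ X

/-- `U` is a Zariski open subset of `X`. -/
def IsZariskiOpenIn {n : ℕ} (X U : Set (Fin n → ℝ)) : Prop :=
  U ⊆ X ∧ IsRealAlgebraicSet (X \ U)

/-- `U` is Zariski dense in `X`. -/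
def IsZariskiDenseIn {n : ℕ} (X U : Set (Fin n → ℝ)) : Prop :=
  ∀ V, IsZariskiClosedIn X V → U ⊆ V → V = X

/-- `f` is regular on `U` : on `U`, `f = p / q` with `q` nonvanishing on `U`. -/
def IsRegularOnSet {n : ℕ} (U : Set (Fin n → ℝ)) (f : (Fin n → ℝ) → ℝ) : Prop :=
  ∃ p q : MvPolynomial (Fin n) ℝ,
    (∀ x ∈ U, MvPolynomial.eval x q ≠ 0) ∧
    ∀ x ∈ U, f x = MvPolynomial.eval x p / MvPolynomial.eval x q

/-- A rational continuous function on `X`: continuous on `X` (euclidean topology) and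
regular on a Zariski-dense Zariski-open subset of `X`. -/
def IsRatCont {n : ℕ} (X : Set (Fin n → ℝ)) (f : (Fin n → ℝ) → ℝ) : Prop :=
  ContinuousOn f X ∧
    ∃ U, IsZariskiOpenIn X U ∧ IsZariskiDenseIn X U ∧ IsRegularOnSet U f

/-- A regulous function on `ℝⁿ`: continuous, and equal to a quotient of polynomials on a
nonempty Zariski open subset of `ℝⁿ`. -/
def IsRegulous {n : ℕ} (f : (Fin n → ℝ) → ℝ) : Prop :=
  Continuous f ∧
    ∃ U : Set (Fin n → ℝ), IsZariskiOpenIn Set.univ U ∧ U.Nonempty ∧ IsRegularOnSet U f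

/-- A regulous function on `X`: the restriction to `X` of a regulous function on `ℝⁿ`. -/
def IsRegulousOn {n : ℕ} (X : Set (Fin n → ℝ)) (f : (Fin n → ℝ) → ℝ) : Prop :=
  ∃ g : (Fin n → ℝ) → ℝ, IsRegulous g ∧ ∀ x ∈ X, f x = g x

/-- The largest Zariski open subset of `X` on which `f` is regular. -/
def regularDomain {n : ℕ} (X : Set (Fin n → ℝ)) (f : (Fin n → ℝ) → ℝ) : Set (Fin n → ℝ) :=
  ⋃₀ {U | IsZariskiOpenIn X U ∧ IsRegularOnSet U f}

/-- The polar locus of `f` on `X`. -/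
def polarLocus {n : ℕ} (X : Set (Fin n → ℝ)) (f : (Fin n → ℝ) → ℝ) : Set (Fin n → ℝ) :=
  X \ regularDomain X f

/-- The ideal of polynomials vanishing on `X`. -/
noncomputable def vanishingIdealOf {n : ℕ} (X : Set (Fin n → ℝ)) : Ideal (MvPolynomial (Fin n) ℝ) where
  carrier := {p | ∀ x ∈ X, MvPolynomial.eval x p = 0}
  add_mem' := by
    intro a b ha hb x hx
    simp [map_add, ha x hx, hb x hx]
  zero_mem' := by intro x hx; simp
  smul_mem' := by
    intro c p hp x hx
    simp [smul_eq_mul, map_mul, hp x hx]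

/-- The dimension of `X`: the Krull dimension of its coordinate ring. -/
noncomputable def algDim {n : ℕ} (X : Set (Fin n → ℝ)) : WithBot ℕ∞ :=
  ringKrullDim (MvPolynomial (Fin n) ℝ ⧸ vanishingIdealOf X)

/-- `x` is a regular (nonsingular) point of `X`: locally around `x`, `X` is the common zero
set of `n - d` polynomials (`d = dim X`) whose gradients at `x` are linearly independent. -/
def IsRegularPoint {n : ℕ} (X : Set (Fin n → ℝ)) (x : Fin n → ℝ) : Prop :=
  x ∈ X ∧ ∃ d : ℕ, algDim X = (d : WithBot ℕ∞) ∧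
    ∃ (p : Fin (n - d) → MvPolynomial (Fin n) ℝ) (U : Set (Fin n → ℝ)),
      IsOpen U ∧ x ∈ U ∧
      X ∩ U = {y ∈ U | ∀ j, MvPolynomial.eval y (p j) = 0} ∧
      LinearIndependent ℝ fun j : Fin (n - d) =>
        fun i : Fin n => MvPolynomial.eval x (MvPolynomial.pderiv i (p j))

/-- `X` is central: it is the euclidean closure of its set of regular points. -/
def IsCentral {n : ℕ} (X : Set (Fin n → ℝ)) : Prop :=
  closure {x | IsRegularPoint X x} = X

/-- A semi-algebraic subset of `ℝᵐ`: a finite union of sets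
`{x | p x = 0, q₁ x > 0, …, q_k x > 0}`. -/
def IsSemialgebraic {m : ℕ} (S : Set (Fin m → ℝ)) : Prop :=
  ∃ (N : ℕ) (P : Fin N → MvPolynomial (Fin m) ℝ) (k : Fin N → ℕ)
    (Q : (i : Fin N) → Fin (k i) → MvPolynomial (Fin m) ℝ),
    S = ⋃ i, {x | MvPolynomial.eval x (P i) = 0 ∧ ∀ j, 0 < MvPolynomial.eval x (Q i j)}

/-- The graph of `f : X → ℝ`, as a subset of `ℝⁿ⁺¹`. -/
def graphOn {n : ℕ} (X : Set (Fin n → ℝ)) (f : (Fin n → ℝ) → ℝ) : Set (Fin (n + 1) → ℝ) :=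
  {y | (fun i : Fin n => y i.castSucc) ∈ X ∧ y (Fin.last n) = f fun i : Fin n => y i.castSucc}

/-- `f` is a semi-algebraic function on `X`: its graph is semi-algebraic in `ℝⁿ⁺¹`. -/
def IsSemialgebraicFnOn {n : ℕ} (X : Set (Fin n → ℝ)) (f : (Fin n → ℝ) → ℝ) : Prop :=
  IsSemialgebraic (graphOn X f)

/-- The interior of `S` in `X` for the euclidean topology of `X`. -/
def interiorIn {n : ℕ} (X S : Set (Fin n → ℝ)) : Set (Fin n → ℝ) :=
  {x ∈ X | ∃ U, IsOpen U ∧ x ∈ U ∧ U ∩ X ⊆ S}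

/-- The euclidean boundary of `S` in `X`: closure of `S` in `X` minus interior of `S` in `X`. -/
def bdIn {n : ℕ} (X S : Set (Fin n → ℝ)) : Set (Fin n → ℝ) :=
  (closure S ∩ X) \ interiorIn X S

/-- The Zariski closure of `E` in `X`: the smallest real algebraic subset of `X`
containing `E`. -/
def zarClosureIn {n : ℕ} (X E : Set (Fin n → ℝ)) : Set (Fin n → ℝ) :=
  ⋂₀ {V | IsZariskiClosedIn X V ∧ E ⊆ V}

/-- `V` is a regulous closed subset of `X`: the zero set of a regulous function on `X`. -/
def IsRegulousClosedIn {n : ℕ} (X V : Set (Fin n → ℝ)) : Prop :=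
  ∃ f : (Fin n → ℝ) → ℝ, IsRegulousOn X f ∧ V = {x ∈ X | f x = 0}

/-- The regulous closure of `E` in `X`: the smallest regulous closed subset of `X`
containing `E`. -/
def regClosureIn {n : ℕ} (X E : Set (Fin n → ℝ)) : Set (Fin n → ℝ) :=
  ⋂₀ {V | IsRegulousClosedIn X V ∧ E ⊆ V}

/-- `X` is an irreducible real algebraic set: it is not the union of two proper real
algebraic subsets. -/
def IsIrreducibleAlgSet {n : ℕ} (X : Set (Fin n → ℝ)) : Prop :=
  IsRealAlgebraicSet X ∧
    ∀ V W : Set (Fin n → ℝ), IsZariskiClosedIn X V → IsZariskiClosedIn X W →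
      X = V ∪ W → V = X ∨ W = X

/-- if `f` is regulous on `X` and `Z(f)` is Zariski closed, then `{f > 0}` and
`{f < 0}` are principal open and `{f ≥ 0}` and `{f ≤ 0}` are principal closed. -/
theorem principal_of_zariski_closed_zero_set {n : ℕ} (X : Set (Fin n → ℝ))
    (hX : IsRealAlgebraicSet X) (f : (Fin n → ℝ) → ℝ) (hf : IsRegulousOn X f)
    (hz : IsZariskiClosedIn X {x ∈ X | f x = 0}) :
    (∃ p : MvPolynomial (Fin n) ℝ,
        {x ∈ X | 0 < f x} = {x ∈ X | 0 < MvPolynomial.eval x p}) ∧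
      (∃ p : MvPolynomial (Fin n) ℝ,
        {x ∈ X | f x < 0} = {x ∈ X | 0 < MvPolynomial.eval x p}) ∧
      (∃ p : MvPolynomial (Fin n) ℝ,
        {x ∈ X | 0 ≤ f x} = {x ∈ X | 0 ≤ MvPolynomial.eval x p}) ∧
      (∃ p : MvPolynomial (Fin n) ℝ,
        {x ∈ X | f x ≤ 0} = {x ∈ X | 0 ≤ MvPolynomial.eval x p}) := by
  obtain ⟨g, ⟨hg, U, ⟨-, k, P, hU⟩, ⟨u, huU⟩, p, q, hq0, hpq⟩, hfg⟩ := hf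
  obtain ⟨kx, Px, hPx⟩ := hX
  obtain ⟨⟨kz, Q, hQ⟩, -⟩ := hz
  have hUiff : ∀ x, x ∈ U ↔ ∃ i, MvPolynomial.eval x (P i) ≠ 0 := by
    intro x
    have := congrArg (fun S => x ∈ S) hU
    simp only [Set.mem_diff, Set.mem_univ, true_and, Set.mem_setOf_eq, eq_iff_iff] at this
    rw [← not_iff_not, this]
    simp
  obtain ⟨i0, hi0⟩ := (hUiff u).1 huU
  have hmul : ∀ x, g x * MvPolynomial.eval x q = MvPolynomial.eval x p := by
    apply RegAux.mul_eq_of_regulous hg hi0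
    intro x hx
    have hxU := (hUiff x).2 ⟨i0, hx⟩
    rw [hpq x hxU, div_mul_cancel₀ _ (hq0 x hxU)]
  have hXiff : ∀ x, x ∈ X ↔ MvPolynomial.eval x (∑ i ∈ Finset.univ, Px i ^ 2) = 0 := by
    intro x
    rw [RegAux.sumsq, hPx]
    simp
  have hZiff : ∀ x, (x ∈ X ∧ f x = 0) ↔
      MvPolynomial.eval x (∑ i ∈ Finset.univ, Q i ^ 2) = 0 := by
    intro x
    rw [RegAux.sumsq]
    have := congrArg (fun S => x ∈ S) hQ
    simp only [Set.mem_setOf_eq, eq_iff_iff] at this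
    rw [this]
    simp
  obtain ⟨r, hr⟩ := RegAux.main (∑ i ∈ Finset.univ, Px i ^ 2) (∑ i ∈ Finset.univ, Q i ^ 2) p q g hg
    u (hq0 u huU) hmul (by
      intro x hx
      have hxX := (hXiff x).2 hx
      rw [← hZiff x, hfg x hxX]
      simp [hxX]) ⊥
  have hs : ∀ x ∈ X, SignType.sign (f x) = SignType.sign (MvPolynomial.eval x r) := by
    intro x hx
    rw [hfg x hx]
    apply hr x ((hXiff x).1 hx)
    intro f hf
    rw [Ideal.mem_bot.1 hf, map_zero]
  have hpos : ∀ x ∈ X, (0 < f x ↔ 0 < MvPolynomial.eval x r) := by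
    intro x hx
    rw [← sign_eq_one_iff, hs x hx, sign_eq_one_iff]
  have hneg : ∀ x ∈ X, (f x < 0 ↔ MvPolynomial.eval x r < 0) := by
    intro x hx
    rw [← sign_eq_neg_one_iff, hs x hx, sign_eq_neg_one_iff]
  refine ⟨⟨r, ?_⟩, ⟨-r, ?_⟩, ⟨r, ?_⟩, ⟨-r, ?_⟩⟩
  · ext x
    exact and_congr_right fun hx => hpos x hx
  · ext x
    refine and_congr_right fun hx => ?_
    rw [map_neg, neg_pos]
    exact hneg x hx
  · ext x
    refine and_congr_right fun hx => ?_
    rw [← not_lt, ← not_lt]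
    exact not_congr (hneg x hx)
  · ext x
    refine and_congr_right fun hx => ?_
    rw [map_neg, neg_nonneg, ← not_lt, ← not_lt]
    exact not_congr (hpos x hx)
end

section
/- Let X ⊆ ℝⁿ be a real algebraic set, let C be a closed semi-algebraic subset of X, and let f, g be regulous functions on X such that Z(f) ∩ C ⊆ Z(g). Then there exist a polynomial function h on X with h > 0 everywhere on X and an odd natural number l such that sign(hf + g^l)(x) = sign(f)(x) for all x ∈ C. -/
open MvPolynomial Set

lemma rl_mono (p : Polynomial ℝ) {a b : ℝ} (hab : a < b)
    (h : ∀ z ∈ Ioo a b, 0 < p.derivative.eval z) : p.eval a < p.eval b := by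
  have := strictMonoOn_of_deriv_pos (convex_Icc a b) (f := fun x => p.eval x)
    p.continuous.continuousOn (by
      intro x hx
      rw [interior_Icc] at hx
      rw [Polynomial.deriv]
      exact h x hx)
  exact this (left_mem_Icc.2 hab.le) (right_mem_Icc.2 hab.le) hab

lemma rl_ivt (p : Polynomial ℝ) {a b : ℝ} (hab : a ≤ b) (ha : p.eval a ≤ 0) (hb : 0 ≤ p.eval b) :
    ∃ z ∈ Icc a b, p.eval z = 0 := by
  have := intermediate_value_Icc hab (f := fun x => p.eval x) p.continuous.continuousOn
  obtain ⟨z, hz, h⟩ := this ⟨ha, hb⟩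
  exact ⟨z, hz, h⟩

lemma rl_rolle (p : Polynomial ℝ) {a b : ℝ} (hab : a ≠ b) (ha : p.eval a = 0) (hb : p.eval b = 0) :
    ∃ z ∈ uIcc a b, p.derivative.eval z = 0 := by
  rcases lt_or_gt_of_ne hab with h | h
  · obtain ⟨z, hz, hz'⟩ := exists_deriv_eq_zero (f := fun x => p.eval x) h
      p.continuous.continuousOn (by rw [ha, hb])
    rw [Polynomial.deriv] at hz'
    exact ⟨z, Icc_subset_uIcc (Ioo_subset_Icc_self hz), hz'⟩
  · obtain ⟨z, hz, hz'⟩ := exists_deriv_eq_zero (f := fun x => p.eval x) h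
      p.continuous.continuousOn (by rw [ha, hb])
    rw [Polynomial.deriv] at hz'
    exact ⟨z, Icc_subset_uIcc' (Ioo_subset_Icc_self hz), hz'⟩

lemma rl_pos_of_no_zero (p : Polynomial ℝ) {a b : ℝ} (h : ∀ z ∈ uIcc a b, p.eval z ≠ 0)
    (ha : 0 < p.eval a) : 0 < p.eval b := by
  by_contra hb
  push Not at hb
  rcases le_total a b with hab | hab
  · obtain ⟨z, hz, h0⟩ := rl_ivt (-p) hab (by simp; linarith) (by simp; linarith)
    simp at h0
    exact h z (Icc_subset_uIcc hz) h0
  · obtain ⟨z, hz, h0⟩ := rl_ivt p hab hb ha.le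
    exact h z (Icc_subset_uIcc' hz) h0

lemma rl_sign_iff (a b : ℝ) : SignType.sign a = SignType.sign b ↔ ((0 < a ↔ 0 < b) ∧ (a < 0 ↔ b < 0)) := by
  rcases lt_trichotomy a 0 with h | h | h <;> rcases lt_trichotomy b 0 with h' | h' | h' <;>
    simp [h, h', h.le, h'.le, not_lt.2 h.le, not_lt.2 h'.le]

lemma rl_sign_const (p : Polynomial ℝ) {a b : ℝ} (h : ∀ z ∈ uIcc a b, p.eval z ≠ 0) :
    SignType.sign (p.eval a) = SignType.sign (p.eval b) := by
  rw [rl_sign_iff]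
  have h' : ∀ z ∈ uIcc b a, p.eval z ≠ 0 := by rwa [uIcc_comm]
  refine ⟨⟨rl_pos_of_no_zero p h, rl_pos_of_no_zero p h'⟩, ?_, ?_⟩
  · intro ha
    have := rl_pos_of_no_zero (-p) (a := a) (b := b) (by simpa using h) (by simpa using ha)
    simpa using this
  · intro ha
    have := rl_pos_of_no_zero (-p) (a := b) (b := a) (by simpa using h') (by simpa using ha)
    simpa using this

/-- piecewise linear -/
noncomputable def rlPL (a b c d x : ℝ) : ℝ :=
  if x ≤ a then x else if x ≤ c then a + (x - a) * ((d - a) / (c - a))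
  else if x < b then b - (b - x) * ((b - d) / (b - c)) else x

lemma rl_pl_lo {a b c d x : ℝ} (h1 : a ≤ x) (h2 : x ≤ c) :
    rlPL a b c d x = a + (x - a) * ((d - a) / (c - a)) := by
  unfold rlPL
  split_ifs with h
  · have : x = a := le_antisymm h h1
    simp [this]
  · rfl

lemma rl_pl_hi {a b c d x : ℝ} (ha : a < c) (hb : c < b) (h1 : c ≤ x) (h2 : x ≤ b) :
    rlPL a b c d x = b - (b - x) * ((b - d) / (b - c)) := by
  have e1 : c - a ≠ 0 := by linarith
  have e2 : b - c ≠ 0 := by linarith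
  unfold rlPL
  split_ifs with h h' h''
  · linarith
  · have : x = c := le_antisymm h' h1
    subst this
    field_simp
    ring
  · rfl
  · have : x = b := le_antisymm h2 (not_lt.1 h'')
    simp [this]

lemma rl_pl_out {a b c d x : ℝ} (ha : a < c) (hb : c < b) (h : x ≤ a ∨ b ≤ x) :
    rlPL a b c d x = x := by
  unfold rlPL
  rcases h with h | h
  · simp [h]
  · rw [if_neg (by linarith), if_neg (by linarith), if_neg (by linarith)]

lemma rl_pl_mono {a b c d : ℝ} (h1 : a < c) (h2 : c < b) (h3 : a < d) (h4 : d < b) :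
    StrictMono (rlPL a b c d) := by
  have k1 : 0 < (d - a) / (c - a) := div_pos (by linarith) (by linarith)
  have k2 : 0 < (b - d) / (b - c) := div_pos (by linarith) (by linarith)
  have A : StrictMonoOn (rlPL a b c d) (Iic a) := by
    intro x hx y hy hxy
    rw [rl_pl_out h1 h2 (Or.inl hx), rl_pl_out h1 h2 (Or.inl hy)]; exact hxy
  have D : StrictMonoOn (rlPL a b c d) (Ici b) := by
    intro x hx y hy hxy
    rw [rl_pl_out h1 h2 (Or.inr hx), rl_pl_out h1 h2 (Or.inr hy)]; exact hxy
  have B : StrictMonoOn (rlPL a b c d) (Icc a c) := by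
    intro x hx y hy hxy
    rw [rl_pl_lo hx.1 hx.2, rl_pl_lo hy.1 hy.2]
    have := mul_lt_mul_of_pos_right (sub_lt_sub_right hxy a) k1
    linarith
  have C : StrictMonoOn (rlPL a b c d) (Icc c b) := by
    intro x hx y hy hxy
    rw [rl_pl_hi h1 h2 hx.1 hx.2, rl_pl_hi h1 h2 hy.1 hy.2]
    have := mul_lt_mul_of_pos_right (sub_lt_sub_left hxy b) k2
    linarith
  have AB := A.union B (c := a) isGreatest_Iic (isLeast_Icc h1.le)
  rw [Iic_union_Icc_eq_Iic h1.le] at AB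
  have ABC := AB.union C (c := c) isGreatest_Iic (isLeast_Icc h2.le)
  rw [Iic_union_Icc_eq_Iic h2.le] at ABC
  exact ABC.Iic_union_Ici D

lemma rl_pl_inv {a b c d : ℝ} (h1 : a < c) (h2 : c < b) (h3 : a < d) (h4 : d < b) (x : ℝ) :
    rlPL a b c d (rlPL a b d c x) = x := by
  have e1 : c - a > 0 := by linarith
  have e2 : b - c > 0 := by linarith
  have e3 : d - a > 0 := by linarith
  have e4 : b - d > 0 := by linarith
  by_cases ho : x ≤ a ∨ b ≤ x
  · rw [rl_pl_out h3 h4 ho, rl_pl_out h1 h2 ho]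
  push Not at ho
  rcases le_total x d with h | h
  · rw [rl_pl_lo ho.1.le h]
    have f1 : 0 ≤ (x - a) * ((c - a) / (d - a)) :=
      mul_nonneg (by linarith) (div_pos e1 e3).le
    have f2 : (x - a) * ((c - a) / (d - a)) ≤ c - a := by
      rw [mul_div_assoc', div_le_iff₀ e3]; nlinarith
    rw [rl_pl_lo (by linarith) (by linarith)]
    field_simp
    ring
  · rw [rl_pl_hi h3 h4 h ho.2.le]
    have f1 : 0 ≤ (b - x) * ((b - c) / (b - d)) :=
      mul_nonneg (by linarith) (div_pos e2 e4).le
    have f2 : (b - x) * ((b - c) / (b - d)) ≤ b - c := by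
      rw [mul_div_assoc', div_le_iff₀ e4]; nlinarith
    rw [rl_pl_hi h1 h2 (by linarith) (by linarith)]
    field_simp
    ring

lemma rl_adjust {a b c d : ℝ} (h1 : a < c) (h2 : c < b) (h3 : a < d) (h4 : d < b) :
    ∃ θ : ℝ ≃o ℝ, θ c = d ∧ (∀ x, (x ≤ a ∨ b ≤ x) → θ x = x) ∧
      ∀ x ∈ Ioo a b, θ x ∈ Ioo a b := by
  have hm := rl_pl_mono h1 h2 h3 h4
  refine ⟨hm.orderIsoOfRightInverse _ (rlPL a b d c) (rl_pl_inv h1 h2 h3 h4), ?_, ?_, ?_⟩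
  · show rlPL a b c d c = d
    rw [rl_pl_lo h1.le le_rfl]
    have : c - a ≠ 0 := by linarith
    field_simp
    ring
  · intro x hx
    exact rl_pl_out h1 h2 hx
  · intro x hx
    have ea := rl_pl_out (d := d) h1 h2 (Or.inl (le_refl a))
    have eb := rl_pl_out (d := d) h1 h2 (Or.inr (le_refl b))
    show rlPL a b c d x ∈ Ioo a b
    constructor
    · have := hm hx.1; rwa [ea] at this
    · have := hm hx.2; rwa [eb] at this

lemma rl_left (p : Polynomial ℝ) (Z : Set ℝ) (hZ : Z.Finite) 
    (hpZ : ∀ z, p.derivative.eval z = 0 → z ∈ Z) (t : ℝ) (ht : t ∉ Z)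
    (hd : 0 < p.derivative.eval t) (hp : 0 < p.eval t) :
    ∃ t1 < t, (∀ z ∈ Ioc t1 t, z ∉ Z) ∧ 0 ≤ p.eval t1 ∧ (p.eval t1 = 0 ∨ t1 ∈ Z) := by
  by_cases hne : (Z ∩ Iio t).Nonempty
  · obtain ⟨a, ⟨haZ, hat⟩, hmax⟩ := Set.exists_max_image (Z ∩ Iio t) id
      (hZ.inter_of_left (Iio t)) hne
    have hgap : ∀ z ∈ Ioc a t, z ∉ Z := by
      intro z hz hzZ
      rcases hz.2.lt_or_eq with h | h
      · exact absurd (hmax z ⟨hzZ, h⟩) (not_le.2 hz.1)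
      · exact ht (h ▸ hzZ)
    by_cases hpa : 0 ≤ p.eval a
    · exact ⟨a, hat, hgap, hpa, Or.inr haZ⟩
    · push Not at hpa
      obtain ⟨z, hz, h0⟩ := rl_ivt p (le_of_lt hat) hpa.le hp.le
      have hzt : z < t := lt_of_le_of_ne hz.2 (by rintro rfl; linarith)
      exact ⟨z, hzt, fun w hw => hgap w ⟨lt_of_le_of_lt hz.1 hw.1, hw.2⟩, h0.ge, Or.inl h0⟩
  · have hgap : ∀ z ≤ t, z ∉ Z := by
      intro z hz hzZ
      rcases hz.lt_or_eq with h | h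
      · exact hne ⟨z, hzZ, h⟩
      · exact ht (h ▸ hzZ)
    have hdpos : ∀ z ≤ t, 0 < p.derivative.eval z := by
      intro z hz
      refine rl_pos_of_no_zero _ (a := t) ?_ hd
      intro w hw h0
      rw [uIcc_of_ge hz] at hw
      exact hgap w hw.2 (hpZ w h0)
    suffices ∃ t2 < t, p.eval t2 ≤ 0 by
      obtain ⟨t2, h2, h2'⟩ := this
      obtain ⟨z, hz, h0⟩ := rl_ivt p h2.le h2' hp.le
      have hzt : z < t := lt_of_le_of_ne hz.2 (by rintro rfl; linarith)
      exact ⟨z, hzt, fun w hw => hgap w hw.2, h0.ge, Or.inl h0⟩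
    by_contra hcon
    push Not at hcon
    have hdeg : 0 < (p.comp (-Polynomial.X)).degree := by
      rw [← Polynomial.natDegree_pos_iff_degree_pos, Polynomial.natDegree_comp]
      simp only [Polynomial.natDegree_neg, Polynomial.natDegree_X, mul_one]
      by_contra h
      rw [Polynomial.eq_C_of_natDegree_eq_zero (by omega : p.natDegree = 0)] at hd
      simp at hd
    have := Polynomial.abs_tendsto_atTop (p.comp (-Polynomial.X)) hdeg
    obtain ⟨w, hw1, hw2⟩ := ((this.eventually_gt_atTop (p.eval t)).and
      (Filter.eventually_gt_atTop (-t))).exists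
    simp only [Polynomial.eval_comp, Polynomial.eval_neg, Polynomial.eval_X] at hw1
    have h3 : -w < t := by linarith
    rw [abs_of_pos (hcon _ h3)] at hw1
    have := rl_mono p h3 (fun z hz => hdpos z hz.2.le)
    linarith

lemma rl_right (p : Polynomial ℝ) (Z : Set ℝ) (hZ : Z.Finite) 
    (hpZ : ∀ z, p.derivative.eval z = 0 → z ∈ Z) (t : ℝ) (ht : t ∉ Z)
    (hd : 0 < p.derivative.eval t) (hp : p.eval t < 0) :
    ∃ t1 > t, (∀ z ∈ Ico t t1, z ∉ Z) ∧ p.eval t1 ≤ 0 ∧ (p.eval t1 = 0 ∨ t1 ∈ Z) := by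
  obtain ⟨t1, h1, h2, h3, h4⟩ := rl_left (-(p.comp (-Polynomial.X))) ((fun x => -x) ⁻¹' Z)
    (hZ.preimage (neg_injective.injOn)) (by
      intro z hz
      simp [Polynomial.derivative_comp] at hz
      exact hpZ _ hz) (-t) (by simpa using ht) (by simpa [Polynomial.derivative_comp] using hd)
      (by simpa using hp)
  refine ⟨-t1, by linarith, ?_, by simpa using h3, by simpa using h4⟩
  intro z hz
  have := h2 (-z) ⟨by linarith [hz.2], by linarith [hz.1]⟩
  simpa using this


structure RLCfg (Zx Zy : Set ℝ) (p q : Polynomial ℝ) (φ : ℝ ≃o ℝ) : Prop where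
  fx : Zx.Finite
  fy : Zy.Finite
  hZ : ∀ t, t ∈ Zx ↔ φ t ∈ Zy
  hd : ∀ t, SignType.sign (p.derivative.eval t) = SignType.sign (q.derivative.eval (φ t))
  hp : ∀ t, p.derivative.eval t = 0 → t ∈ Zx
  hr : ∀ t ∈ Zx, SignType.sign (p.eval t) = SignType.sign (q.eval (φ t))

lemma rl_sign_zero {a b : ℝ} (h : SignType.sign a = SignType.sign b) : a = 0 ↔ b = 0 := by
  rw [← sign_eq_zero_iff, h, sign_eq_zero_iff]

lemma rl_sign_pos {a b : ℝ} (h : SignType.sign a = SignType.sign b) : 0 < a ↔ 0 < b :=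
  ((rl_sign_iff a b).1 h).1

lemma rl_sign_neg {a b : ℝ} (h : SignType.sign a = SignType.sign b) : a < 0 ↔ b < 0 :=
  ((rl_sign_iff a b).1 h).2

lemma rl_sign_nonneg {a b : ℝ} (h : SignType.sign a = SignType.sign b) : 0 ≤ a ↔ 0 ≤ b := by
  rw [← not_lt, ← not_lt, rl_sign_neg h]

lemma rl_sign_nonpos {a b : ℝ} (h : SignType.sign a = SignType.sign b) : a ≤ 0 ↔ b ≤ 0 := by
  rw [← not_lt, ← not_lt, rl_sign_pos h]

lemma rl_neg_sign (a b : ℝ) (h : SignType.sign a = SignType.sign b) :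
    SignType.sign (-a) = SignType.sign (-b) := by
  rw [rl_sign_iff] at *
  simp [h]

namespace RLCfg
variable {Zx Zy : Set ℝ} {p q : Polynomial ℝ} {φ : ℝ ≃o ℝ}

lemma hq (c : RLCfg Zx Zy p q φ) : ∀ t, q.derivative.eval t = 0 → t ∈ Zy := by
  intro t ht
  have h1 := c.hd (φ.symm t)
  rw [OrderIso.apply_symm_apply] at h1
  have := (c.hZ _).1 (c.hp _ ((rl_sign_zero h1).2 ht))
  rwa [OrderIso.apply_symm_apply] at this

lemma symm (c : RLCfg Zx Zy p q φ) : RLCfg Zy Zx q p φ.symm where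
  fx := c.fy
  fy := c.fx
  hZ t := by rw [c.hZ, OrderIso.apply_symm_apply]
  hd t := by rw [c.hd, OrderIso.apply_symm_apply]
  hp := c.hq
  hr t ht := by
    have := c.hr (φ.symm t) (by rwa [c.hZ, OrderIso.apply_symm_apply])
    rw [this, OrderIso.apply_symm_apply]

lemma neg (c : RLCfg Zx Zy p q φ) : RLCfg Zx Zy (-p) (-q) φ where
  fx := c.fx
  fy := c.fy
  hZ := c.hZ
  hd t := by
    simp only [Polynomial.derivative_neg, Polynomial.eval_neg]
    exact rl_neg_sign _ _ (c.hd t)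
  hp t ht := by
    simp only [Polynomial.derivative_neg, Polynomial.eval_neg, neg_eq_zero] at ht
    exact c.hp t ht
  hr t ht := by
    simp only [Polynomial.eval_neg]
    exact rl_neg_sign _ _ (c.hr t ht)

/-- derivative is positive on Z-free intervals -/
lemma dpos (c : RLCfg Zx Zy p q φ) {t z : ℝ} (h : ∀ w ∈ uIcc t z, w ∉ Zx)
    (ht : 0 < p.derivative.eval t) : 0 < p.derivative.eval z :=
  rl_pos_of_no_zero _ (fun w hw h0 => h w hw (c.hp w h0)) ht

lemma zero_gap_pos (c : RLCfg Zx Zy p q φ) {t : ℝ} (ht : t ∉ Zx) (h0 : p.eval t = 0)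
    (hd : 0 < p.derivative.eval t) :
    ∃ s, q.eval s = 0 ∧ ∀ z ∈ uIcc (φ t) s, z ∉ Zy := by
  have hqd : 0 < q.derivative.eval (φ t) := (rl_sign_pos (c.hd t)).1 hd
  have hs : φ t ∉ Zy := fun h => ht ((c.hZ t).2 h)
  rcases lt_trichotomy (q.eval (φ t)) 0 with h | h | h
  · obtain ⟨s1, h1, h2, h3, h4⟩ := rl_right q Zy c.fy c.hq (φ t) hs hqd h
    have hs1 : s1 ∉ Zy := by
      intro hs1
      have e := c.symm.hr s1 hs1
      have h5 := (rl_sign_nonpos e).1 h3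
      have h6 : t < φ.symm s1 := by rwa [← φ.lt_iff_lt, φ.apply_symm_apply]
      have := rl_mono p h6 (fun z hz => by
        refine c.dpos (t := t) ?_ hd
        intro w hw
        rw [uIcc_of_le hz.1.le] at hw
        rw [c.hZ]
        apply h2
        refine ⟨φ.monotone hw.1, ?_⟩
        rw [← φ.apply_symm_apply s1, φ.lt_iff_lt]
        exact lt_of_le_of_lt hw.2 hz.2)
      linarith
    refine ⟨s1, h4.resolve_right hs1, ?_⟩
    intro z hz
    rw [uIcc_of_le h1.le] at hz
    rcases hz.2.lt_or_eq with h | h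
    · exact h2 z ⟨hz.1, h⟩
    · rwa [h]
  · exact ⟨φ t, h, by simpa using hs⟩
  · obtain ⟨s1, h1, h2, h3, h4⟩ := rl_left q Zy c.fy c.hq (φ t) hs hqd h
    have hs1 : s1 ∉ Zy := by
      intro hs1
      have e := c.symm.hr s1 hs1
      have h5 := (rl_sign_nonneg e).1 h3
      have h6 : φ.symm s1 < t := by rwa [← φ.lt_iff_lt, φ.apply_symm_apply]
      have := rl_mono p h6 (fun z hz => by
        refine c.dpos (t := t) ?_ hd
        intro w hw
        rw [uIcc_of_ge hz.2.le] at hw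
        rw [c.hZ]
        apply h2
        refine ⟨?_, φ.monotone hw.2⟩
        rw [← φ.apply_symm_apply s1, φ.lt_iff_lt]
        exact lt_of_lt_of_le hz.1 hw.1)
      linarith
    refine ⟨s1, h4.resolve_right hs1, ?_⟩
    intro z hz
    rw [uIcc_of_ge h1.le] at hz
    rcases hz.1.lt_or_eq with h | h
    · exact h2 z ⟨h, hz.2⟩
    · rwa [← h]

lemma zero_gap (c : RLCfg Zx Zy p q φ) {t : ℝ} (ht : t ∉ Zx) (h0 : p.eval t = 0) :
    ∃ s, q.eval s = 0 ∧ ∀ z ∈ uIcc (φ t) s, z ∉ Zy := by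
  rcases lt_trichotomy (p.derivative.eval t) 0 with h | h | h
  · obtain ⟨s, h1, h2⟩ := c.neg.zero_gap_pos ht (by simpa using h0) (by simpa using h)
    exact ⟨s, by simpa using h1, h2⟩
  · exact absurd (c.hp t h) ht
  · exact c.zero_gap_pos ht h0 h

lemma pos_of_pos (c : RLCfg Zx Zy p q φ) (hz : ∀ t, p.eval t = 0 ↔ q.eval (φ t) = 0)
    {t : ℝ} (ht : t ∉ Zx) (hd : 0 < p.derivative.eval t) (hp : 0 < p.eval t) :
    0 < q.eval (φ t) := by
  obtain ⟨t1, h1, h2, h3, h4⟩ := rl_left p Zx c.fx c.hp t ht hd hp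
  have h5 : 0 ≤ q.eval (φ t1) := by
    rcases h4 with h | h
    · exact ((hz t1).1 h).ge
    · exact (rl_sign_nonneg (c.hr t1 h)).1 h3
  have := rl_mono q (φ.strictMono h1) (fun z hz => by
    have hqd : 0 < q.derivative.eval (φ t) := (rl_sign_pos (c.hd t)).1 hd
    refine c.symm.dpos (t := φ t) ?_ hqd
    intro w hw
    rw [uIcc_of_ge hz.2.le] at hw
    rw [c.symm.hZ]
    apply h2
    constructor
    · rw [← φ.lt_iff_lt, φ.apply_symm_apply]
      exact lt_of_lt_of_le hz.1 hw.1
    · rw [← φ.le_iff_le, φ.apply_symm_apply]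
      exact hw.2)
  linarith

lemma sign_pos (c : RLCfg Zx Zy p q φ) (hz : ∀ t, p.eval t = 0 ↔ q.eval (φ t) = 0)
    {t : ℝ} (ht : t ∉ Zx) (hd : 0 < p.derivative.eval t) :
    SignType.sign (p.eval t) = SignType.sign (q.eval (φ t)) := by
  have h1 : 0 < p.eval t ↔ 0 < q.eval (φ t) := by
    refine ⟨c.pos_of_pos hz ht hd, fun h => ?_⟩
    have := c.symm.pos_of_pos (t := φ t) (fun t => by rw [hz, φ.apply_symm_apply])
      (by rwa [← c.hZ]) ((rl_sign_pos (c.hd t)).1 hd) h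
    simpa using this
  rw [rl_sign_iff]
  refine ⟨h1, ?_⟩
  have h2 := hz t
  rcases lt_trichotomy (p.eval t) 0 with h | h | h <;>
  rcases lt_trichotomy (q.eval (φ t)) 0 with h' | h' | h' <;> grind

lemma sign_all (c : RLCfg Zx Zy p q φ) (hz : ∀ t, p.eval t = 0 ↔ q.eval (φ t) = 0)
    (t : ℝ) : SignType.sign (p.eval t) = SignType.sign (q.eval (φ t)) := by
  by_cases ht : t ∈ Zx
  · exact c.hr t ht
  rcases lt_trichotomy (p.derivative.eval t) 0 with h | h | h
  · have := c.neg.sign_pos (by simpa using hz) ht (by simpa using h)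
    simpa using rl_neg_sign _ _ this
  · exact absurd (c.hp t h) ht
  · exact c.sign_pos hz ht h

end RLCfg

def RLMt {ι : Type*} (s : Finset ι) (Qx Qy : ι → Polynomial ℝ) (φ : ℝ ≃o ℝ) : Prop :=
  ∀ i ∈ s, ∀ t, SignType.sign ((Qx i).eval t) = SignType.sign ((Qy i).eval (φ t))

def RLZr {ι : Type*} (s : Finset ι) (Q : ι → Polynomial ℝ) : Set ℝ :=
  {t | ∃ i ∈ s, Q i ≠ 0 ∧ (Q i).eval t = 0}

lemma rl_zr_finite {ι : Type*} (s : Finset ι) (Q : ι → Polynomial ℝ) : (RLZr s Q).Finite := by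
  have : RLZr s Q = ⋃ i ∈ s, {t | Q i ≠ 0 ∧ (Q i).eval t = 0} := by
    ext t; simp only [RLZr, mem_iUnion, mem_ofPred_eq, exists_prop]
  rw [this]
  refine Set.Finite.biUnion s.finite_toSet (fun i _ => ?_)
  by_cases h : Q i = 0
  · simp [h]
  · refine ((Q i).roots.toFinset.finite_toSet).subset ?_
    intro t ht
    simpa using ht

lemma rl_open_gap {Z : Set ℝ} (hZ : Z.Finite) {c d : ℝ} (h : ∀ z ∈ uIcc c d, z ∉ Z) :
    ∃ a b, a < c ∧ c < b ∧ a < d ∧ d < b ∧ ∀ z ∈ Ioo a b, z ∉ Z := by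
  have h1 : (Zᶜ) ∈ nhds (min c d) := hZ.isClosed.isOpen_compl.mem_nhds (h _ ⟨le_rfl, min_le_max⟩)
  have h2 : (Zᶜ) ∈ nhds (max c d) := hZ.isClosed.isOpen_compl.mem_nhds (h _ ⟨min_le_max, le_rfl⟩)
  obtain ⟨l1, u1, ⟨h3, h4⟩, h5⟩ := mem_nhds_iff_exists_Ioo_subset.1 h1
  obtain ⟨l2, u2, ⟨h6, h7⟩, h8⟩ := mem_nhds_iff_exists_Ioo_subset.1 h2
  have := min_le_left c d
  have := min_le_right c d
  have := le_max_left c d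
  have := le_max_right c d
  refine ⟨l1, u2, by linarith, by linarith, by linarith, by linarith, ?_⟩
  intro z hz
  by_cases hz1 : z < min c d
  · exact h5 ⟨hz.1, by linarith⟩
  · by_cases hz2 : max c d < z
    · exact h8 ⟨by linarith, hz.2⟩
    · exact h z ⟨not_lt.1 hz1, not_lt.1 hz2⟩

lemma rl_step {ι : Type*} (s : Finset ι) (Qx Qy : ι → Polynomial ℝ) (p q : Polynomial ℝ)
    (hp0 : p ≠ 0)
    (hc : ∀ φ, RLMt s Qx Qy φ → RLCfg (RLZr s Qx) (RLZr s Qy) p q φ)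
    (hex : ∃ φ, RLMt s Qx Qy φ) :
    ∃ φ, RLMt s Qx Qy φ ∧ ∀ t, SignType.sign (p.eval t) = SignType.sign (q.eval (φ t)) := by
  classical
  have key : ∀ W : Finset ℝ, (∀ w ∈ W, p.eval w = 0) →
      ∃ φ, RLMt s Qx Qy φ ∧ ∀ w ∈ W, q.eval (φ w) = 0 := by
    intro W
    induction W using Finset.induction_on with
    | empty => intro _; obtain ⟨φ, h⟩ := hex; exact ⟨φ, h, by simp⟩
    | insert t0 W ht0 ih =>
      intro hW
      obtain ⟨φ, hφ, hφW⟩ := ih (fun w hw => hW w (Finset.mem_insert_of_mem hw))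
      have c := hc φ hφ
      have hpt0 := hW t0 (Finset.mem_insert_self _ _)
      by_cases hq0 : q.eval (φ t0) = 0
      · refine ⟨φ, hφ, ?_⟩
        intro w hw
        rcases Finset.mem_insert.1 hw with rfl | hw
        · exact hq0
        · exact hφW w hw
      have hZ0 : t0 ∉ RLZr s Qx := fun h => hq0 ((rl_sign_zero (c.hr t0 h)).1 hpt0)
      obtain ⟨s0, hs0, hgap⟩ := c.zero_gap hZ0 hpt0
      obtain ⟨a, b, h1, h2, h3, h4, hab⟩ := rl_open_gap c.fy hgap
      obtain ⟨θ, hθ0, hθ1, hθ2⟩ := rl_adjust h1 h2 h3 h4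
      have hout : ∀ y, y ∉ Ioo a b → θ y = y := by
        intro y hy
        apply hθ1
        by_contra hcon
        push Not at hcon
        exact hy hcon
      refine ⟨φ.trans θ, ?_, ?_⟩
      · intro i hi t
        rw [hφ i hi t]
        show _ = SignType.sign ((Qy i).eval (θ (φ t)))
        by_cases hy : φ t ∈ Ioo a b
        · by_cases hQ : Qy i = 0
          · simp [hQ]
          apply rl_sign_const
          intro z hz h0
          exact hab z (ordConnected_Ioo.uIcc_subset hy (hθ2 _ hy) hz) ⟨i, hi, hQ, h0⟩
        · rw [hout _ hy]
      · intro w hw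
        show q.eval (θ (φ w)) = 0
        rcases Finset.mem_insert.1 hw with rfl | hw
        · rw [hθ0, hs0]
        by_cases hy : φ w ∈ Ioo a b
        · exfalso
          have hwt : w ≠ t0 := fun h => ht0 (h ▸ hw)
          obtain ⟨z, hz, hz0⟩ := rl_rolle p hwt (hW w (Finset.mem_insert_of_mem hw)) hpt0
          have hzZ := (c.hZ z).1 (c.hp z hz0)
          refine hab _ ?_ hzZ
          refine ordConnected_Ioo.uIcc_subset hy ⟨h1, h2⟩ ?_
          rcases le_total w t0 with h | h
          · rw [uIcc_of_le h] at hz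
            exact Icc_subset_uIcc ⟨φ.monotone hz.1, φ.monotone hz.2⟩
          · rw [uIcc_of_ge h] at hz
            exact Icc_subset_uIcc' ⟨φ.monotone hz.1, φ.monotone hz.2⟩
        · rw [hout _ hy]; exact hφW w hw
  obtain ⟨φ, hφ, hφW⟩ := key p.roots.toFinset (by intro w hw; simpa [hp0] using hw)
  have c := hc φ hφ
  refine ⟨φ, hφ, c.sign_all ?_⟩
  intro t
  refine ⟨fun h => hφW t (by simpa [hp0] using h), fun h => ?_⟩
  by_cases ht : t ∈ RLZr s Qx
  · exact (rl_sign_zero (c.hr t ht)).2 h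
  obtain ⟨t1, h1, h2⟩ := c.symm.zero_gap (t := φ t) (by rwa [← c.hZ]) h
  rw [φ.symm_apply_apply] at h2
  by_cases hte : t = t1
  · rw [hte, h1]
  exfalso
  obtain ⟨z, hz, hz0⟩ := rl_rolle q (fun h => hte (φ.injective h)) h (hφW t1 (by simpa [hp0] using h1))
  have hzZ := (c.symm.hZ z).1 (c.hq z hz0)
  refine h2 _ ?_ hzZ
  rcases le_total t t1 with h | h
  · rw [uIcc_of_le (φ.monotone h)] at hz
    refine Icc_subset_uIcc ⟨?_, ?_⟩
    · rw [← φ.le_iff_le, φ.apply_symm_apply]; exact hz.1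
    · rw [← φ.le_iff_le, φ.apply_symm_apply]; exact hz.2
  · rw [uIcc_of_ge (φ.monotone h)] at hz
    refine Icc_subset_uIcc' ⟨?_, ?_⟩
    · rw [← φ.le_iff_le, φ.apply_symm_apply]; exact hz.1
    · rw [← φ.le_iff_le, φ.apply_symm_apply]; exact hz.2


lemma rl_prem_aux {R : Type*} [CommRing R] (Q : Polynomial R) (hQ : 0 < Q.natDegree) :
    ∀ (N : ℕ) (P : Polynomial R), P.natDegree ≤ N → ∃ (m : ℕ) (S T : Polynomial R),
      Polynomial.C (Q.leadingCoeff ^ m) * P = Q * S + T ∧ T.natDegree < Q.natDegree := by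
  intro N
  induction N with
  | zero => 
    intro P hP
    exact ⟨0, 0, P, by simp, by omega⟩
  | succ N ih =>
    intro P hP
    by_cases h : P.natDegree < Q.natDegree
    · exact ⟨0, 0, P, by simp, h⟩
    push Not at h
    have h1 := Polynomial.natDegree_cancelLeads_lt_of_natDegree_le_natDegree h (by omega)
    obtain ⟨m, S, T, e, hT⟩ := ih (Q.cancelLeads P) (by omega)
    refine ⟨m + 1, S + Polynomial.C (Q.leadingCoeff ^ m) * Polynomial.C P.leadingCoeff *
      Polynomial.X ^ (P.natDegree - Q.natDegree), T, ?_, hT⟩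
    unfold Polynomial.cancelLeads at e
    rw [Nat.sub_eq_zero_of_le h] at e
    rw [pow_succ, Polynomial.C_mul]
    linear_combination e

lemma rl_prem_exists {R : Type*} [CommRing R] (P Q : Polynomial R) :
    ∃ T : Polynomial R, 0 < Q.natDegree → T.natDegree < Q.natDegree ∧ ∃ (m : ℕ) (S : Polynomial R),
      Polynomial.C ((Q.leadingCoeff ^ m) ^ 2) * P = Q * S + T := by
  by_cases hQ : 0 < Q.natDegree
  · obtain ⟨m, S, T, e, hT⟩ := rl_prem_aux Q hQ P.natDegree P le_rfl
    refine ⟨Polynomial.C (Q.leadingCoeff ^ m) * T, fun _ => ⟨?_, m, 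
      Polynomial.C (Q.leadingCoeff ^ m) * S, ?_⟩⟩
    · exact lt_of_le_of_lt (Polynomial.natDegree_C_mul_le _ _) hT
    · rw [sq, Polynomial.C_mul]
      linear_combination Polynomial.C (Q.leadingCoeff ^ m) * e
  · exact ⟨0, fun h => absurd h hQ⟩

noncomputable def rlPrem {R : Type*} [CommRing R] (P Q : Polynomial R) : Polynomial R :=
  (rl_prem_exists P Q).choose

def RLOp {R : Type*} [CommRing R] (F : Finset (Polynomial R)) (Q r : Polynomial R) : Prop :=
  r = Q.derivative ∨ r = Q.eraseLead ∨ ∃ P ∈ F, Q.natDegree ≤ P.natDegree ∧ r = rlPrem P Q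

def RLClosed {R : Type*} [CommRing R] (k : ℕ) (F : Finset (Polynomial R)) : Prop :=
  ∀ Q ∈ F, 0 < Q.natDegree → ∀ r, RLOp F Q r → k ≤ r.natDegree → r ∈ F

lemma rl_op_deg {R : Type*} [CommRing R] {F : Finset (Polynomial R)} {Q r : Polynomial R}
    (h : RLOp F Q r) (hQ : 0 < Q.natDegree) : r.natDegree < Q.natDegree := by
  rcases h with rfl | rfl | ⟨P, _, _, rfl⟩
  · exact Polynomial.natDegree_derivative_lt hQ.ne'
  · have := Polynomial.eraseLead_natDegree_le Q; omega
  · exact ((rl_prem_exists P Q).choose_spec hQ).1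

lemma rl_next {R : Type*} [CommRing R] (F : Finset (Polynomial R)) :
    ∃ F' : Finset (Polynomial R), ∀ r, r ∈ F' ↔ (r ∈ F ∨ ∃ Q ∈ F, 0 < Q.natDegree ∧ RLOp F Q r) := by
  have hf : {r | r ∈ F ∨ ∃ Q ∈ F, 0 < Q.natDegree ∧ RLOp F Q r}.Finite := by
    refine ((F.finite_toSet.union ((F.finite_toSet.image Polynomial.derivative).union
      ((F.finite_toSet.image Polynomial.eraseLead).union
      (F.finite_toSet.image2 rlPrem F.finite_toSet))))).subset ?_
    rintro r (h | ⟨Q, hQ, _, rfl | rfl | ⟨P, hP, _, rfl⟩⟩)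
    · exact Or.inl h
    · exact Or.inr (Or.inl ⟨Q, hQ, rfl⟩)
    · exact Or.inr (Or.inr (Or.inl ⟨Q, hQ, rfl⟩))
    · exact Or.inr (Or.inr (Or.inr ⟨P, hP, Q, hQ, rfl⟩))
  exact ⟨hf.toFinset, by simp⟩

lemma rl_closure {R : Type*} [CommRing R] : ∀ (k : ℕ) (F : Finset (Polynomial R)), RLClosed k F →
    ∃ F', F ⊆ F' ∧ RLClosed 0 F' := by
  intro k
  induction k with
  | zero => intro F hF; exact ⟨F, subset_rfl, hF⟩
  | succ k ih =>
    intro F hF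
    obtain ⟨F', hF'⟩ := rl_next F
    have hlow : ∀ r ∈ F', k + 1 ≤ r.natDegree → r ∈ F := by
      intro r hr hk
      rcases (hF' r).1 hr with h | ⟨Q, hQ, h0, hop⟩
      · exact h
      · exact hF Q hQ h0 r hop hk
    obtain ⟨F'', h1, h2⟩ := ih F' (by
      intro Q hQ h0 r hop hk
      have hd := rl_op_deg hop h0
      have hQF := hlow Q hQ (by omega)
      rw [hF']
      right
      refine ⟨Q, hQF, h0, ?_⟩
      rcases hop with h | h | ⟨P, hP, hd', h⟩
      · exact Or.inl h
      · exact Or.inr (Or.inl h)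
      · exact Or.inr (Or.inr ⟨P, hlow P hP (by omega), hd', h⟩))
    exact ⟨F'', fun r hr => h1 ((hF' r).2 (Or.inl hr)), h2⟩

lemma rl_closure' {R : Type*} [CommRing R] (F : Finset (Polynomial R)) :
    ∃ F', F ⊆ F' ∧ RLClosed 0 F' := by
  refine rl_closure (F.sup Polynomial.natDegree) F ?_
  intro Q hQ h0 r hop hk
  have := rl_op_deg hop h0
  have := Finset.le_sup (f := Polynomial.natDegree) hQ
  omega

/-- root reduction: sign of P at roots of Q -/
lemma rl_prem_sign {R : Type*} [CommRing R] (x : R →+* ℝ) (P Q : Polynomial R) (hQ : 0 < Q.natDegree)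
    (hl : x Q.leadingCoeff ≠ 0) (t : ℝ) (ht : (Q.map x).eval t = 0) :
    SignType.sign ((P.map x).eval t) = SignType.sign (((rlPrem P Q).map x).eval t) := by
  obtain ⟨m, S, e⟩ := ((rl_prem_exists P Q).choose_spec hQ).2
  change _ = Q * S + rlPrem P Q at e
  have e2 := congrArg (fun T => (T.map x).eval t) e
  simp only [Polynomial.map_mul, Polynomial.map_C, Polynomial.eval_mul, Polynomial.eval_C,
    Polynomial.map_add, Polynomial.eval_add, ht, zero_mul, zero_add] at e2
  simp only [map_pow] at e2
  rw [← e2]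
  have : 0 < (x Q.leadingCoeff ^ m) ^ 2 := by positivity
  rw [rl_sign_iff]
  constructor
  · rw [mul_pos_iff_of_pos_left this]
  · constructor
    · intro h; exact mul_neg_of_pos_of_neg this h
    · intro h; by_contra h'; push Not at h'; exact absurd (mul_nonneg this.le h') (not_le.2 h)

lemma rl_map_eraseLead {R : Type*} [CommRing R] (x : R →+* ℝ) (Q : Polynomial R)
    (hl : x Q.leadingCoeff = 0) : Q.eraseLead.map x = Q.map x := by
  have := congrArg (Polynomial.map x) (Polynomial.eraseLead_add_C_mul_X_pow Q)
  rw [Polynomial.map_add, Polynomial.map_mul, Polynomial.map_C, hl, Polynomial.C_0, zero_mul,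
    add_zero] at this
  exact this

lemma rl_good_root {R : Type*} [CommRing R] (x : R →+* ℝ) (s : Finset (Polynomial R))
    (hs : RLClosed 0 s) (t : ℝ) : ∀ (N : ℕ) (Q : Polynomial R), Q.natDegree ≤ N → Q ∈ s → 
    Q.map x ≠ 0 → (Q.map x).eval t = 0 → ∃ Q ∈ s, 0 < Q.natDegree ∧ x Q.leadingCoeff ≠ 0 ∧
      (Q.map x).eval t = 0 := by
  intro N
  induction N with
  | zero =>
    intro Q hQ _ h0 h1
    rw [Polynomial.eq_C_of_natDegree_eq_zero (by omega : Q.natDegree = 0)] at h0 h1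
    simp at h0 h1
    exact absurd h1 h0
  | succ N ih =>
    intro Q hQ hQs h0 h1
    by_cases hd : Q.natDegree = 0
    · rw [Polynomial.eq_C_of_natDegree_eq_zero hd] at h0 h1
      simp at h0 h1
      exact absurd h1 h0
    by_cases hl : x Q.leadingCoeff = 0
    · have e := rl_map_eraseLead x Q hl
      refine ih Q.eraseLead ?_ (hs Q hQs (by omega) _ (Or.inr (Or.inl rfl)) (Nat.zero_le _)) 
        (by rwa [e]) (by rwa [e])
      have := Polynomial.eraseLead_natDegree_le Q; omega
    · exact ⟨Q, hQs, by omega, hl, h1⟩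

lemma rl_ts_closed {R : Type*} [CommRing R] (x y : R →+* ℝ) (F : Finset (Polynomial R)) :
    RLClosed 0 F → (∀ P ∈ F, ∀ i, SignType.sign (x (P.coeff i)) = SignType.sign (y (P.coeff i))) →
    ∃ φ, RLMt F (fun P => P.map x) (fun P => P.map y) φ := by
  classical
  induction F using Finset.induction_on_max_value (fun P : Polynomial R => P.natDegree) with
  | empty => intro _ _; exact ⟨OrderIso.refl ℝ, by intro i hi; simp at hi⟩
  | insert P s hPs hmax ih =>
    intro hcl hA
    have hmem : ∀ Q ∈ insert P s, 0 < Q.natDegree → ∀ r, RLOp (insert P s) Q r → r ∈ s := by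
      intro Q hQ h0 r hop
      have h1 := hcl Q hQ h0 r hop (Nat.zero_le _)
      have h2 := rl_op_deg hop h0
      refine (Finset.mem_insert.1 h1).resolve_left ?_
      rintro rfl
      rcases Finset.mem_insert.1 hQ with rfl | hQ
      · exact lt_irrefl _ h2
      · exact absurd (hmax Q hQ) (not_le.2 h2)
    have hcs : RLClosed 0 s := by
      intro Q hQ h0 r hop _
      refine hmem Q (Finset.mem_insert_of_mem hQ) h0 r ?_
      rcases hop with h | h | ⟨P', hP', hd', h⟩
      · exact Or.inl h
      · exact Or.inr (Or.inl h)
      · exact Or.inr (Or.inr ⟨P', Finset.mem_insert_of_mem hP', hd', h⟩)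
    have hex := ih hcs (fun Q hQ => hA Q (Finset.mem_insert_of_mem hQ))
    have hPm := Finset.mem_insert_self P s
    suffices ∃ φ, RLMt s (fun P => P.map x) (fun P => P.map y) φ ∧
        ∀ t, SignType.sign ((P.map x).eval t) = SignType.sign ((P.map y).eval (φ t)) by
      obtain ⟨φ, h1, h2⟩ := this
      refine ⟨φ, fun Q hQ => ?_⟩
      rcases Finset.mem_insert.1 hQ with rfl | hQ
      · exact h2
      · exact h1 Q hQ
    by_cases hd : P.natDegree = 0
    · obtain ⟨φ, hφ⟩ := hex
      refine ⟨φ, hφ, fun t => ?_⟩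
      have := hA P hPm 0
      rw [Polynomial.eq_C_of_natDegree_eq_zero hd]
      simpa using this
    have hd' : 0 < P.natDegree := by omega
    have hlc : x P.leadingCoeff = 0 ↔ y P.leadingCoeff = 0 := rl_sign_zero (hA P hPm P.natDegree)
    by_cases hl : x P.leadingCoeff = 0
    · obtain ⟨φ, hφ⟩ := hex
      refine ⟨φ, hφ, fun t => ?_⟩
      rw [← rl_map_eraseLead x P hl, ← rl_map_eraseLead y P (hlc.1 hl)]
      exact hφ _ (hmem P hPm hd' _ (Or.inr (Or.inl rfl))) t
    have hz : ∀ Q ∈ s, Q.map x = 0 ↔ Q.map y = 0 := by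
      intro Q hQ
      have := hA Q (Finset.mem_insert_of_mem hQ)
      simp only [Polynomial.ext_iff, Polynomial.coeff_map, Polynomial.coeff_zero]
      exact forall_congr' fun i => rl_sign_zero (this i)
    have hndx : (P.map x).natDegree = P.natDegree := Polynomial.natDegree_map_of_leadingCoeff_ne_zero x hl
    have hp0 : P.map x ≠ 0 := by
      intro h; rw [h] at hndx; simp at hndx; omega
    have hpd0 : P.derivative.map x ≠ 0 := by
      rw [← Polynomial.derivative_map]
      intro h
      have := Polynomial.derivative_eq_zero.1 h
      omega
    have hds := hmem P hPm hd' _ (Or.inl rfl)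
    refine rl_step s _ _ (P.map x) (P.map y) hp0 ?_ hex
    intro φ hφ
    refine ⟨rl_zr_finite _ _, rl_zr_finite _ _, ?_, ?_, ?_, ?_⟩
    · intro t
      refine exists_congr fun Q => and_congr_right fun hQ => ?_
      rw [ne_eq, ne_eq, hz Q hQ, rl_sign_zero (hφ Q hQ t)]
    · intro t
      rw [Polynomial.derivative_map, Polynomial.derivative_map]
      exact hφ _ hds t
    · intro t ht
      rw [Polynomial.derivative_map] at ht
      exact ⟨_, hds, hpd0, ht⟩
    · rintro t ⟨Q, hQ, hQ0, hQt⟩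
      obtain ⟨Q, hQs, hQd, hQl, hQt⟩ := rl_good_root x s hcs t Q.natDegree Q le_rfl hQ hQ0 hQt
      have hQm := Finset.mem_insert_of_mem (b := P) hQs
      rw [rl_prem_sign x P Q hQd hQl t hQt, rl_prem_sign y P Q hQd
        (fun h => hQl ((rl_sign_zero (hA Q hQm _)).2 h)) (φ t) ((rl_sign_zero (hφ Q hQs t)).1 hQt)]
      exact hφ _ (hmem Q hQm hQd _ (Or.inr (Or.inr ⟨P, hPm, hmax Q hQs, rfl⟩))) t

theorem rl_ts {R : Type*} [CommRing R] (L : Finset (Polynomial R)) :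
    ∃ A : Finset R, ∀ x y : R →+* ℝ, (∀ a ∈ A, SignType.sign (x a) = SignType.sign (y a)) →
      ∃ φ, RLMt L (fun P => P.map x) (fun P => P.map y) φ := by
  classical
  obtain ⟨F, hLF, hF⟩ := rl_closure' L
  refine ⟨F.biUnion (fun P => P.support.image P.coeff), fun x y h => ?_⟩
  obtain ⟨φ, hφ⟩ := rl_ts_closed x y F hF (by
    intro P hP i
    by_cases hi : P.coeff i = 0
    · simp [hi]
    · apply h
      rw [Finset.mem_biUnion]
      exact ⟨P, hP, Finset.mem_image.2 ⟨i, by simpa using hi, rfl⟩⟩)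
  exact ⟨φ, fun P hP => hφ P (hLF hP)⟩


def RLSA {σ : Type} (S : Set (σ → ℝ)) : Prop :=
  ∃ A : Finset (MvPolynomial σ ℝ), ∀ x y, (∀ a ∈ A, SignType.sign (eval x a) =
    SignType.sign (eval y a)) → x ∈ S → y ∈ S

namespace RLSA
variable {σ τ : Type}

lemma compl {S : Set (σ → ℝ)} (h : RLSA S) : RLSA Sᶜ := by
  obtain ⟨A, hA⟩ := h
  exact ⟨A, fun x y hxy hx hy => hx (hA y x (fun a ha => (hxy a ha).symm) hy)⟩

lemma inter {S T : Set (σ → ℝ)} (h : RLSA S) (h' : RLSA T) : RLSA (S ∩ T) := by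
  classical
  obtain ⟨A, hA⟩ := h
  obtain ⟨B, hB⟩ := h'
  exact ⟨A ∪ B, fun x y hxy hx => ⟨hA x y (fun a ha => hxy a (Finset.mem_union_left _ ha)) hx.1,
    hB x y (fun a ha => hxy a (Finset.mem_union_right _ ha)) hx.2⟩⟩

lemma iUnion {N : ℕ} {S : Fin N → Set (σ → ℝ)} (h : ∀ i, RLSA (S i)) : RLSA (⋃ i, S i) := by
  classical
  choose A hA using h
  refine ⟨Finset.univ.biUnion A, fun x y hxy hx => ?_⟩
  obtain ⟨i, hi⟩ := mem_iUnion.1 hx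
  exact mem_iUnion.2 ⟨i, hA i x y (fun a ha => hxy a (Finset.mem_biUnion.2 ⟨i, Finset.mem_univ _, ha⟩)) hi⟩

lemma iInter {N : ℕ} {S : Fin N → Set (σ → ℝ)} (h : ∀ i, RLSA (S i)) : RLSA (⋂ i, S i) := by
  have := (iUnion (fun i => (h i).compl)).compl
  simpa [compl_iUnion] using this

lemma pos (P : MvPolynomial σ ℝ) : RLSA {x | 0 < eval x P} :=
  ⟨{P}, fun x y h hx => (rl_sign_pos (h P (by simp))).1 hx⟩

lemma zero (P : MvPolynomial σ ℝ) : RLSA {x | eval x P = 0} :=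
  ⟨{P}, fun x y h hx => (rl_sign_zero (h P (by simp))).1 hx⟩

lemma ne (P : MvPolynomial σ ℝ) : RLSA {x | eval x P ≠ 0} := (zero P).compl

lemma lt (P Q : MvPolynomial σ ℝ) : RLSA {x | eval x P < eval x Q} := by
  have := pos (Q - P)
  simpa using this

lemma le (P Q : MvPolynomial σ ℝ) : RLSA {x | eval x P ≤ eval x Q} := by
  have := (lt Q P).compl
  convert this using 1
  ext x
  simp

lemma preimage {S : Set (τ → ℝ)} (h : RLSA S) (F : τ → MvPolynomial σ ℝ) :
    RLSA {x | (fun i => eval x (F i)) ∈ S} := by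
  classical
  obtain ⟨A, hA⟩ := h
  refine ⟨A.image (bind₁ F), fun x y hxy hx => hA _ _ (fun a ha => ?_) hx⟩
  have e : ∀ x : σ → ℝ, eval x (bind₁ F a) = eval (fun i => eval x (F i)) a :=
    fun x => eval₂Hom_bind₁ _ _ _ _
  rw [← e, ← e]
  exact hxy _ (Finset.mem_image_of_mem _ ha)

lemma proj {S : Set (Option σ → ℝ)} (h : RLSA S) :
    RLSA {x : σ → ℝ | ∃ t : ℝ, (fun o : Option σ => o.elim t x) ∈ S} := by
  classical
  obtain ⟨A, hA⟩ := h
  have e : ∀ (x : σ → ℝ) (t : ℝ) (a : MvPolynomial (Option σ) ℝ),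
      eval (fun o : Option σ => o.elim t x) a =
      ((optionEquivLeft ℝ σ a).map (eval x : MvPolynomial σ ℝ →+* ℝ)).eval t := by
    intro x t a
    induction a using MvPolynomial.induction_on with
    | C r => simp [optionEquivLeft_C]
    | add p q hp hq => simp only [map_add, Polynomial.map_add, Polynomial.eval_add, hp, hq]
    | mul_X p i hp =>
      simp only [map_mul, Polynomial.map_mul, Polynomial.eval_mul, hp]
      cases i <;> simp [optionEquivLeft_X_some, optionEquivLeft_X_none]
  obtain ⟨B, hB⟩ := rl_ts (A.image (optionEquivLeft ℝ σ))
  refine ⟨B, fun x y hxy => ?_⟩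
  rintro ⟨t, ht⟩
  obtain ⟨φ, hφ⟩ := hB (eval x) (eval y) hxy
  refine ⟨φ t, hA _ _ (fun a ha => ?_) ht⟩
  rw [e, e]
  exact hφ _ (Finset.mem_image_of_mem _ ha) t

lemma proj_fin (k : ℕ) : ∀ {σ : Type} {S : Set (σ ⊕ Fin k → ℝ)}, RLSA S →
    RLSA {x : σ → ℝ | ∃ y : Fin k → ℝ, Sum.elim x y ∈ S} := by
  induction k with
  | zero =>
    intro σ S h
    have := h.preimage (σ := σ) (fun i => Sum.elim (fun i => X i) (fun i => i.elim0) i)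
    convert this using 1
    ext x
    have : ∀ y : Fin 0 → ℝ, Sum.elim x y = (fun i : σ ⊕ Fin 0 => 
        eval x (Sum.elim (fun i => X i) (fun i => i.elim0) i : MvPolynomial σ ℝ)) := by
      intro y; funext i
      rcases i with i | i
      · simp
      · exact i.elim0
    simp only [mem_ofPred_eq, this, exists_const]
  | succ k ih =>
    intro σ S h
    have h1 := h.preimage (σ := Option σ ⊕ Fin k) (fun i => Sum.elim (fun i => X (Sum.inl (some i)))
      (fun i : Fin (k + 1) => Fin.cases (X (Sum.inl none)) (fun j => X (Sum.inr j)) i) i)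
    have h2 := (ih h1).proj
    convert h2 using 1
    ext x
    have e : ∀ (t : ℝ) (y : Fin k → ℝ), (fun i : σ ⊕ Fin (k + 1) => 
        eval (Sum.elim (fun o : Option σ => o.elim t x) y) (Sum.elim (fun i => X (Sum.inl (some i)))
      (fun i : Fin (k + 1) => Fin.cases (X (Sum.inl none)) (fun j => X (Sum.inr j)) i) i : 
        MvPolynomial (Option σ ⊕ Fin k) ℝ)) = Sum.elim x (Fin.cons t y) := by
      intro t y
      funext i
      rcases i with i | i
      · simp
      · refine Fin.cases ?_ (fun j => ?_) i <;> simp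
    simp only [mem_ofPred_eq, e]
    constructor
    · rintro ⟨y, hy⟩
      exact ⟨y 0, Fin.tail y, by rwa [Fin.cons_self_tail]⟩
    · rintro ⟨t, y, hy⟩
      exact ⟨_, hy⟩

lemma of_semialg {m : ℕ} {S : Set (Fin m → ℝ)} (h : IsSemialgebraic S) : RLSA S := by
  obtain ⟨N, P, k, Q, rfl⟩ := h
  refine iUnion fun i => ?_
  have := (zero (P i)).inter (iInter (fun j => pos (Q i j)))
  convert this using 1
  ext x
  simp

end RLSA

lemma rl_poly_bound (a : Polynomial ℝ) : ∃ (c : ℝ) (M : ℕ), 0 ≤ c ∧ ∀ u : ℝ, 1 ≤ u → |a.eval u| ≤ c * u ^ M := by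
  induction a using Polynomial.induction_on' with
  | add p q hp hq =>
    obtain ⟨c, M, hc, h⟩ := hp
    obtain ⟨c', M', hc', h'⟩ := hq
    refine ⟨c + c', M + M', by positivity, fun u hu => ?_⟩
    rw [Polynomial.eval_add]
    have h1 := h u hu
    have h2 := h' u hu
    have h3 : u ^ M ≤ u ^ (M + M') := pow_le_pow_right₀ hu (by omega)
    have h4 : u ^ M' ≤ u ^ (M + M') := pow_le_pow_right₀ hu (by omega)
    have := abs_add_le (p.eval u) (q.eval u)
    nlinarith
  | monomial n r =>
    refine ⟨|r|, n, abs_nonneg _, fun u hu => ?_⟩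
    rw [Polynomial.eval_monomial, abs_mul, abs_pow, abs_of_nonneg (by linarith : 0 ≤ u)]

lemma rl_poly2_bound (P : Polynomial (Polynomial ℝ)) : ∃ (c : ℝ) (M : ℕ), 0 ≤ c ∧ 
    ∀ u v : ℝ, 1 ≤ u → 0 ≤ v → v ≤ 1 → |P.evalEval u v| ≤ c * u ^ M := by
  induction P using Polynomial.induction_on' with
  | add p q hp hq =>
    obtain ⟨c, M, hc, h⟩ := hp
    obtain ⟨c', M', hc', h'⟩ := hq
    refine ⟨c + c', M + M', by positivity, fun u v hu hv hv' => ?_⟩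
    rw [Polynomial.evalEval_add]
    have h1 := h u v hu hv hv'
    have h2 := h' u v hu hv hv'
    have h3 : u ^ M ≤ u ^ (M + M') := pow_le_pow_right₀ hu (by omega)
    have h4 : u ^ M' ≤ u ^ (M + M') := pow_le_pow_right₀ hu (by omega)
    have := abs_add_le (p.evalEval u v) (q.evalEval u v)
    nlinarith
  | monomial n r =>
    obtain ⟨c, M, hc, h⟩ := rl_poly_bound r
    refine ⟨c, M, hc, fun u v hu hv hv' => ?_⟩
    have e : (Polynomial.monomial n r).evalEval u v = r.eval u * v ^ n := by
      simp [Polynomial.evalEval, Polynomial.eval_monomial]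
    rw [e, abs_mul, abs_of_nonneg (pow_nonneg hv n)]
    have h1 := h u hu
    have h2 : v ^ n ≤ 1 := pow_le_one₀ hv hv'
    have h3 := pow_nonneg hv n
    nlinarith [abs_nonneg (r.eval u)]

lemma rl_poly_far (a : Polynomial ℝ) (ha : a ≠ 0) : ∃ (u0 c : ℝ) (s : SignType), 1 ≤ u0 ∧ 0 < c ∧
    ∀ u, u0 ≤ u → c ≤ |a.eval u| ∧ SignType.sign (a.eval u) = s := by
  by_cases hd : a.natDegree = 0
  · rw [Polynomial.eq_C_of_natDegree_eq_zero hd] at ha ⊢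
    refine ⟨1, |a.coeff 0|, SignType.sign (a.coeff 0), le_rfl, by simpa using ha, by simp⟩
  · have := Polynomial.abs_tendsto_atTop a (Polynomial.natDegree_pos_iff_degree_pos.1 (by omega))
    obtain ⟨u0, h⟩ := Filter.eventually_atTop.1 (this.eventually_ge_atTop 1)
    refine ⟨max u0 1, 1, SignType.sign (a.eval (max u0 1)), le_max_right _ _, one_pos, fun u hu => ?_⟩
    refine ⟨h u (le_trans (le_max_left _ _) hu), ?_⟩
    apply rl_sign_const
    intro z hz h0
    rw [uIcc_of_ge hu] at hz
    have := h z (le_trans (le_max_left _ _) hz.1)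
    rw [h0] at this
    norm_num at this

lemma rl_sign_add {a b : ℝ} (h : |b| < |a|) : SignType.sign (b + a) = SignType.sign a := by
  rw [rl_sign_iff]
  rcases abs_cases a with ⟨h1, h2⟩ | ⟨h1, h2⟩ <;> rcases abs_cases b with ⟨h3, h4⟩ | ⟨h3, h4⟩ <;>
  constructor <;> constructor <;> intro <;> linarith

lemma rl_germ2 : ∀ (d : ℕ) (P : Polynomial (Polynomial ℝ)), P.natDegree ≤ d → 
    ∃ (u0 : ℝ) (N : ℕ) (s : SignType), 1 ≤ u0 ∧
    ∀ u v : ℝ, u0 ≤ u → 0 < v → v * u ^ N < 1 → SignType.sign (P.evalEval u v) = s := by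
  have key : ∀ (P : Polynomial (Polynomial ℝ)), P.coeff 0 ≠ 0 → 
      ∃ (u0 : ℝ) (N : ℕ) (s : SignType), 1 ≤ u0 ∧
      ∀ u v : ℝ, u0 ≤ u → 0 < v → v * u ^ N < 1 → SignType.sign (P.evalEval u v) = s := by
    intro P h0
    obtain ⟨u0, c, s, hu0, hc, h⟩ := rl_poly_far _ h0
    obtain ⟨c', M, hc', h'⟩ := rl_poly2_bound P.divX
    refine ⟨max u0 (c' / c), M + 1, s, le_trans hu0 (le_max_left _ _), fun u v hu hv huv => ?_⟩
    have hu1 : u0 ≤ u := le_trans (le_max_left _ _) hu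
    have hu2 : c' / c ≤ u := le_trans (le_max_right _ _) hu
    have hu3 : 1 ≤ u := hu0.trans hu1
    rw [div_le_iff₀ hc] at hu2
    have e : P.evalEval u v = P.divX.evalEval u v * v + (P.coeff 0).eval u := by
      conv_lhs => rw [← Polynomial.divX_mul_X_add P]
      simp [Polynomial.evalEval]
    have hv1 : v ≤ 1 := by
      have : 1 ≤ u ^ (M + 1) := one_le_pow₀ hu3
      nlinarith
    obtain ⟨h1, h2⟩ := h u hu1
    have h3 := h' u v hu3 hv.le hv1
    rw [e, rl_sign_add, h2]
    refine lt_of_lt_of_le ?_ h1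
    rw [abs_mul, abs_of_pos hv]
    have h4 : |P.divX.evalEval u v| * v ≤ c' * u ^ M * v := mul_le_mul_of_nonneg_right h3 hv.le
    have h5 : c' * u ^ M * v ≤ (u * c) * u ^ M * v := by
      have : 0 ≤ u ^ M * v := by positivity
      nlinarith
    have h6 : (u * c) * u ^ M * v = c * (v * u ^ (M + 1)) := by ring
    nlinarith
  intro d
  induction d with
  | zero =>
    intro P hP
    by_cases h0 : P.coeff 0 = 0
    · have : P = 0 := by
        rw [Polynomial.eq_C_of_natDegree_eq_zero (by omega : P.natDegree = 0), h0]; simp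
      subst this
      exact ⟨1, 0, 0, le_rfl, by simp⟩
    · exact key P h0
  | succ d ih =>
    intro P hP
    by_cases h0 : P.coeff 0 = 0
    · obtain ⟨u0, N, s, hu0, h⟩ := ih P.divX (by rw [Polynomial.natDegree_divX_eq_natDegree_tsub_one]; omega)
      refine ⟨u0, N, s, hu0, fun u v hu hv huv => ?_⟩
      rw [← h u v hu hv huv]
      have e : P.evalEval u v = P.divX.evalEval u v * v := by
        conv_lhs => rw [← Polynomial.divX_mul_X_add P]
        simp [Polynomial.evalEval, h0]
      rw [e, sign_mul, sign_pos hv, mul_one]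
    · exact key P h0

lemma rl_biv (a : MvPolynomial (Fin 2) ℝ) (u v : ℝ) : eval ![u, v] a =
    (aeval ![Polynomial.C Polynomial.X, Polynomial.X] a : Polynomial (Polynomial ℝ)).evalEval u v := by
  induction a using MvPolynomial.induction_on with
  | C r => simp [Polynomial.evalEval, Polynomial.algebraMap_apply]
  | add p q hp hq => simp only [map_add, Polynomial.evalEval_add, hp, hq]
  | mul_X p i hp =>
    simp only [map_mul, Polynomial.evalEval_mul, hp, aeval_X, eval_X]
    fin_cases i <;> simp [Polynomial.evalEval]

lemma rl_region (A : Finset (MvPolynomial (Fin 2) ℝ)) : ∃ (u0 : ℝ) (N : ℕ), 1 ≤ u0 ∧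
    ∀ u v u' v' : ℝ, u0 ≤ u → 0 < v → v * u ^ N < 1 → u0 ≤ u' → 0 < v' → v' * u' ^ N < 1 →
    ∀ a ∈ A, SignType.sign (eval ![u, v] a) = SignType.sign (eval ![u', v'] a) := by
  classical
  induction A using Finset.induction_on with
  | empty => exact ⟨1, 0, le_rfl, by simp⟩
  | insert a A ha ih =>
    obtain ⟨u0, N, hu0, h⟩ := ih
    let G : MvPolynomial (Fin 2) ℝ →ₐ[ℝ] Polynomial (Polynomial ℝ) :=
      aeval ![Polynomial.C Polynomial.X, Polynomial.X]
    have e : ∀ u v : ℝ, eval ![u, v] a = (G a).evalEval u v := fun u v => rl_biv a u v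
    obtain ⟨u1, N1, s, hu1, h1⟩ := rl_germ2 _ (G a) le_rfl
    have hmono : ∀ {u v : ℝ} {k l : ℕ}, 1 ≤ u → 0 < v → k ≤ l → v * u ^ l < 1 → v * u ^ k < 1 := by
      intro u v k l hu hv hkl hl
      refine lt_of_le_of_lt (mul_le_mul_of_nonneg_left (pow_le_pow_right₀ hu hkl) hv.le) hl
    refine ⟨max u0 u1, max N N1, le_trans hu0 (le_max_left _ _), ?_⟩
    intro u v u' v' h2 h3 h4 h5 h6 h7 b hb
    rw [max_le_iff] at h2 h5
    rcases Finset.mem_insert.1 hb with rfl | hb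
    · rw [e, e, h1 u v h2.2 h3 (hmono (hu0.trans h2.1) h3 (le_max_right _ _) h4),
        h1 u' v' h5.2 h6 (hmono (hu0.trans h5.1) h6 (le_max_right _ _) h7)]
    · exact h u v u' v' h2.1 h3 (hmono (hu0.trans h2.1) h3 (le_max_left _ _) h4) h5.1 h6
        (hmono (hu0.trans h5.1) h6 (le_max_left _ _) h7) b hb


lemma rl_dense {n : ℕ} (q : MvPolynomial (Fin n) ℝ) (hq : q ≠ 0) :
    Dense {x : Fin n → ℝ | eval x q ≠ 0} := by
  rw [dense_iff_inter_open]
  rintro O hO ⟨x, hx⟩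
  obtain ⟨ε, hε, hb⟩ := Metric.isOpen_iff.1 hO x hx
  by_contra hcon
  apply hq
  refine funext_set (fun i => Ioo (x i - ε) (x i + ε)) (fun i => Ioo_infinite (by linarith)) ?_
  intro y hy
  rw [map_zero]
  by_contra h0
  refine hcon ⟨y, hb ?_, h0⟩
  rw [Metric.mem_ball, dist_pi_lt_iff hε]
  intro i
  have := hy i (mem_univ i)
  rw [Real.dist_eq, abs_lt]
  constructor <;> linarith [this.1, this.2]

lemma rl_regulous {n : ℕ} {f : (Fin n → ℝ) → ℝ} (hf : IsRegulous f) :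
    ∃ p q : MvPolynomial (Fin n) ℝ, q ≠ 0 ∧ ∀ x, eval x q * f x = eval x p := by
  obtain ⟨hc, U, ⟨_, k, r, hr⟩, ⟨x0, hx0⟩, p, q, hq, hpq⟩ := hf
  have h1 : ∃ i, eval x0 (r i) ≠ 0 := by
    by_contra hcon
    push Not at hcon
    have : x0 ∈ univ \ U := by rw [hr]; exact hcon
    exact this.2 hx0
  obtain ⟨i, hi⟩ := h1
  have hd := rl_dense (r i) (by rintro h; simp [h] at hi)
  refine ⟨p, q, by rintro rfl; exact hq x0 hx0 (by simp), ?_⟩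
  have hcl : IsClosed {x | eval x q * f x = eval x p} :=
    isClosed_eq ((MvPolynomial.continuous_eval q).mul hc) (MvPolynomial.continuous_eval p)
  have hsub : {x | eval x (r i) ≠ 0} ⊆ {x | eval x q * f x = eval x p} := by
    intro x hx
    have hxU : x ∈ U := by
      by_contra h
      have : x ∈ univ \ U := ⟨mem_univ _, h⟩
      rw [hr] at this
      exact hx (this i)
    show eval x q * f x = eval x p
    rw [hpq x hxU]
    field_simp [hq x hxU]
  intro x
  have := (hcl.closure_subset_iff.2 hsub) (hd x)
  exact this

lemma rl_ball_compact {n : ℕ} (u : ℝ) : IsCompact {x : Fin n → ℝ | ∑ i, x i ^ 2 ≤ u} := by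
  refine IsCompact.of_isClosed_subset (isCompact_Icc (a := fun _ => -(|u| + 1)) (b := fun _ => |u| + 1)) ?_ ?_
  · exact isClosed_le (by fun_prop) continuous_const
  · intro x hx
    have h : ∀ i, x i ^ 2 ≤ u := fun i =>
      (Finset.single_le_sum (f := fun i => x i ^ 2) (fun j _ => sq_nonneg _) (Finset.mem_univ i)).trans hx
    have h2 := le_abs_self u
    constructor
    · intro i
      have := h i
      show -(|u| + 1) ≤ x i
      nlinarith [abs_nonneg u]
    · intro i
      have := h i
      show x i ≤ |u| + 1
      nlinarith [abs_nonneg u]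

/-- the approximating condition -/
def RLB {n : ℕ} (C : Set (Fin n → ℝ)) (pf qf pg qg : MvPolynomial (Fin n) ℝ) (u v ε : ℝ) : Prop :=
  ∃ x ∈ C, ∃ y : Fin n → ℝ, ∑ i, (x i - y i) ^ 2 < ε ∧ ∑ i, x i ^ 2 ≤ u ∧
    eval y qf ≠ 0 ∧ eval y qg ≠ 0 ∧ (eval y qg) ^ 2 ≤ (u * eval y pg) ^ 2 ∧
    (eval y pf) ^ 2 ≤ (v * eval y qf) ^ 2

lemma rl_B_sa {n : ℕ} (C : Set (Fin n → ℝ)) (hC : RLSA C) (pf qf pg qg : MvPolynomial (Fin n) ℝ) :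
    RLSA {w : Fin 3 → ℝ | RLB C pf qf pg qg (w 0) (w 1) (w 2)} := by
  let ι := (Fin 3 ⊕ Fin n) ⊕ Fin n
  let xx : Fin n → MvPolynomial ι ℝ := fun i => X (Sum.inl (Sum.inr i))
  let yy : Fin n → MvPolynomial ι ℝ := fun i => X (Sum.inr i)
  let ww : Fin 3 → MvPolynomial ι ℝ := fun i => X (Sum.inl (Sum.inl i))
  let rn : MvPolynomial (Fin n) ℝ → MvPolynomial ι ℝ := fun p => rename (Sum.inr) p
  have h := (hC.preimage xx).inter ((RLSA.lt (∑ i, (xx i - yy i) ^ 2) (ww 2)).inter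
    ((RLSA.le (∑ i, (xx i) ^ 2) (ww 0)).inter ((RLSA.ne (rn qf)).inter ((RLSA.ne (rn qg)).inter
    ((RLSA.le ((rn qg) ^ 2) ((ww 0 * rn pg) ^ 2)).inter
    (RLSA.le ((rn pf) ^ 2) ((ww 1 * rn qf) ^ 2)))))))
  have h2 := RLSA.proj_fin n (RLSA.proj_fin n h)
  convert h2 using 1
  ext w
  simp only [RLB, mem_inter_iff, mem_ofPred_eq, xx, yy, ww, rn, map_sum, map_pow, map_sub, map_mul,
    eval_X, eval_rename, Sum.elim_inl, Sum.elim_inr, Sum.elim_comp_inr]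
  constructor
  · rintro ⟨x, hx, y, h⟩
    exact ⟨x, y, hx, h⟩
  · rintro ⟨x, y, hx, h⟩
    exact ⟨x, hx, y, h⟩

lemma rl_B'_sa {n : ℕ} (C : Set (Fin n → ℝ)) (hC : RLSA C) (pf qf pg qg : MvPolynomial (Fin n) ℝ) :
    RLSA {w : Fin 2 → ℝ | ∀ ε, 0 < ε → RLB C pf qf pg qg (w 0) (w 1) ε} := by
  have h1 := (rl_B_sa C hC pf qf pg qg).preimage (σ := Option (Fin 2))
    (![X (some 0), X (some 1), X none])
  have h2 := ((RLSA.pos (X none : MvPolynomial (Option (Fin 2)) ℝ)).inter h1.compl).proj.compl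
  convert h2 using 1
  ext w
  simp

/-- compactness direction -/
lemma rl_B_to {n : ℕ} {C : Set (Fin n → ℝ)} (hC : IsClosed C) {f g : (Fin n → ℝ) → ℝ}
    (hfc : Continuous f) (hgc : Continuous g) {pf qf pg qg : MvPolynomial (Fin n) ℝ}
    (hf : ∀ x, eval x qf * f x = eval x pf) (hg : ∀ x, eval x qg * g x = eval x pg)
    {u v : ℝ} (h : ∀ ε, 0 < ε → RLB C pf qf pg qg u v ε) :
    ∃ x ∈ C, ∑ i, x i ^ 2 ≤ u ∧ 1 ≤ (u * g x) ^ 2 ∧ f x ^ 2 ≤ v ^ 2 := by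
  have h' : ∀ k : ℕ, ∃ x ∈ C, ∃ y : Fin n → ℝ, ∑ i, (x i - y i) ^ 2 < 1 / ((k : ℝ) + 1) ∧
      ∑ i, x i ^ 2 ≤ u ∧ 1 ≤ (u * g y) ^ 2 ∧ f y ^ 2 ≤ v ^ 2 := by
    intro k
    obtain ⟨x, hx, y, h1, h2, h3, h4, h5, h6⟩ := h (1 / ((k : ℝ) + 1)) (by positivity)
    refine ⟨x, hx, y, h1, h2, ?_, ?_⟩
    · rw [← hg] at h5
      have : 0 < (eval y qg) ^ 2 := by positivity
      nlinarith
    · rw [← hf] at h6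
      have : 0 < (eval y qf) ^ 2 := by positivity
      by_contra hcon
      push Not at hcon
      nlinarith
  choose x hxC y h1 h2 h3 h4 using h'
  obtain ⟨a, ha, φ, hφ, hlim⟩ := (rl_ball_compact (n := n) u).tendsto_subseq h2
  have hlimy : Filter.Tendsto (y ∘ φ) Filter.atTop (nhds a) := by
    rw [tendsto_pi_nhds] at hlim ⊢
    intro i
    have hsq : Filter.Tendsto (fun k => (x (φ k) i - y (φ k) i) ^ 2) Filter.atTop (nhds 0) := by
      refine squeeze_zero (fun k => sq_nonneg _) (fun k => ?_)
        (tendsto_one_div_add_atTop_nhds_zero_nat.comp hφ.tendsto_atTop)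
      refine le_trans ?_ (h1 (φ k)).le
      exact Finset.single_le_sum (f := fun i => (x (φ k) i - y (φ k) i) ^ 2)
        (fun j _ => sq_nonneg _) (Finset.mem_univ i)
    have hd : Filter.Tendsto (fun k => x (φ k) i - y (φ k) i) Filter.atTop (nhds 0) := by
      have := hsq.sqrt
      simp only [Real.sqrt_sq_eq_abs, Real.sqrt_zero] at this
      exact (tendsto_zero_iff_abs_tendsto_zero _).2 this
    have := (hlim i).sub hd
    simpa using this
  refine ⟨a, hC.mem_of_tendsto hlim (Filter.Eventually.of_forall fun k => hxC _), ha, ?_, ?_⟩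
  · have : Filter.Tendsto (fun k => (u * g (y (φ k))) ^ 2) Filter.atTop (nhds ((u * g a) ^ 2)) :=
      ((((hgc.tendsto a).comp hlimy).const_mul u).pow 2)
    exact ge_of_tendsto' this (fun k => h3 _)
  · have : Filter.Tendsto (fun k => (f (y (φ k))) ^ 2) Filter.atTop (nhds ((f a) ^ 2)) :=
      (((hfc.tendsto a).comp hlimy).pow 2)
    exact le_of_tendsto' this (fun k => h4 _)

lemma rl_B_of {n : ℕ} {C : Set (Fin n → ℝ)} {f g : (Fin n → ℝ) → ℝ}
    (hfc : Continuous f) (hgc : Continuous g) {pf qf pg qg : MvPolynomial (Fin n) ℝ}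
    (hqf : qf ≠ 0) (hqg : qg ≠ 0)
    (hf : ∀ x, eval x qf * f x = eval x pf) (hg : ∀ x, eval x qg * g x = eval x pg)
    {u v : ℝ} {x : Fin n → ℝ} (hx : x ∈ C) (h1 : ∑ i, x i ^ 2 ≤ u) (h2 : 1 < (u * g x) ^ 2)
    (h3 : f x ^ 2 < v ^ 2) (ε : ℝ) (hε : 0 < ε) : RLB C pf qf pg qg u v ε := by
  have hO : IsOpen ({y : Fin n → ℝ | ∑ i, (x i - y i) ^ 2 < ε} ∩ ({y | 1 < (u * g y) ^ 2} ∩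
      {y | f y ^ 2 < v ^ 2})) := by
    refine (isOpen_lt (by fun_prop) continuous_const).inter
      ((isOpen_lt continuous_const (by fun_prop)).inter (isOpen_lt (by fun_prop) continuous_const))
  obtain ⟨y, ⟨hy1, hy2, hy3⟩, hy4⟩ := (rl_dense (qf * qg) (mul_ne_zero hqf hqg)).inter_open_nonempty _ hO
    ⟨x, by simpa using hε, h2, h3⟩
  simp only [mem_ofPred_eq, map_mul, ne_eq, mul_eq_zero, not_or] at hy1 hy2 hy3 hy4
  refine ⟨x, hx, y, hy1, h1, hy4.1, hy4.2, ?_, ?_⟩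
  · rw [← hg]
    have : 0 < (eval y qg) ^ 2 := by have := hy4.2; positivity
    nlinarith
  · rw [← hf]
    have : 0 < (eval y qf) ^ 2 := by have := hy4.1; positivity
    nlinarith

lemma rl_main {n : ℕ} {C : Set (Fin n → ℝ)} (hC : IsClosed C) (hCs : RLSA C)
    {f g : (Fin n → ℝ) → ℝ}
    (hfc : Continuous f) (hgc : Continuous g) {pf qf pg qg : MvPolynomial (Fin n) ℝ}
    (hqf : qf ≠ 0) (hqg : qg ≠ 0)
    (hf : ∀ x, eval x qf * f x = eval x pf) (hg : ∀ x, eval x qg * g x = eval x pg)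
    (hz : ∀ x ∈ C, f x = 0 → g x = 0) :
    ∃ (K : ℝ) (N : ℕ), 1 ≤ K ∧ ∀ x ∈ C, ∀ u, K ≤ u → ∑ i, x i ^ 2 ≤ u → 1 < u * |g x| →
      1 ≤ 2 * u ^ N * |f x| := by
  obtain ⟨A, hA⟩ := rl_B'_sa C hCs pf qf pg qg
  obtain ⟨u0, N, hu0, hreg⟩ := rl_region A
  have hnot : ∀ u v, u0 ≤ u → 0 < v → v * u ^ N < 1 → ¬ ∀ ε, 0 < ε → RLB C pf qf pg qg u v ε := by
    intro u v hu hv huv hB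
    have hall : ∀ v', 0 < v' → v' * u ^ N < 1 → ∀ ε, 0 < ε → RLB C pf qf pg qg u v' ε := by
      intro v' hv' huv'
      have := hA ![u, v] ![u, v'] (hreg u v u v' hu hv huv hu hv' huv') (by simpa using hB)
      simpa using this
    have hKc : IsCompact (C ∩ ({x | ∑ i, x i ^ 2 ≤ u} ∩ {x | 1 ≤ (u * g x) ^ 2})) := by
      refine IsCompact.inter_left ((rl_ball_compact u).inter_right ?_) hC
      exact isClosed_le continuous_const (by fun_prop)
    obtain ⟨x1, hx1, h1, h2, _⟩ := rl_B_to hC hfc hgc hf hg hB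
    obtain ⟨m, ⟨hmC, hm1, hm2⟩, hmin⟩ := hKc.exists_isMinOn ⟨x1, hx1, h1, h2⟩
      (f := fun x => f x ^ 2) (by fun_prop)
    have hfm : 0 < |f m| := by
      rw [abs_pos]
      intro h0
      have := hz m hmC h0
      simp only [mem_ofPred_eq, this] at hm2
      norm_num at hm2
    have hu1 : 0 < u ^ N := by have : 0 < u := by linarith
                               positivity
    obtain ⟨x2, hx2, h3, h4, h5⟩ := rl_B_to hC hfc hgc hf hg
      (hall (min v (|f m| / 2)) (lt_min hv (by linarith))
        (lt_of_le_of_lt (mul_le_mul_of_nonneg_right (min_le_left _ _) hu1.le) huv))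
    have h6 := hmin ⟨hx2, h3, h4⟩
    simp only [mem_ofPred_eq] at h6
    have h7 : (min v (|f m| / 2)) ^ 2 ≤ (|f m| / 2) ^ 2 :=
      pow_le_pow_left₀ (le_min hv.le (by linarith)) (min_le_right _ _) 2
    have h8 : f m ^ 2 = |f m| ^ 2 := (sq_abs _).symm
    nlinarith
  refine ⟨u0, N, hu0, fun x hx u hu h1 h2 => ?_⟩
  by_contra hcon
  push Not at hcon
  have hup : 0 < u := by linarith
  have huN : 0 < u ^ N := by positivity
  have hfv : |f x| < 1 / (2 * u ^ N) := by
    rw [lt_div_iff₀ (by positivity)]; linarith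
  refine hnot u (1 / (2 * u ^ N)) hu (by positivity) (by field_simp; norm_num) 
    (rl_B_of hfc hgc hqf hqg hf hg hx h1 ?_ ?_)
  · have : (u * g x) ^ 2 = (u * |g x|) ^ 2 := by rw [mul_pow, mul_pow, sq_abs]
    rw [this]
    nlinarith
  · rw [← sq_abs (f x)]
    exact pow_lt_pow_left₀ hfv (abs_nonneg _) (by norm_num)

lemma rl_growth {n : ℕ} {g : (Fin n → ℝ) → ℝ}
    (hgc : Continuous g) {pg qg : MvPolynomial (Fin n) ℝ} (hqg : qg ≠ 0)
    (hg : ∀ x, eval x qg * g x = eval x pg) :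
    ∃ (K : ℝ) (N : ℕ), 1 ≤ K ∧ ∀ x, |g x| ≤ 2 * (K + 1 + ∑ i, x i ^ 2) ^ N := by
  have hq : qg ^ 2 + pg ^ 2 ≠ 0 := by
    intro h
    apply hqg
    apply MvPolynomial.funext
    intro x
    have := congrArg (eval x) h
    simp only [map_add, map_pow, map_zero] at this ⊢
    nlinarith [sq_nonneg (eval x qg), sq_nonneg (eval x pg)]
  obtain ⟨K, N, hK, h⟩ := rl_main (C := univ) isClosed_univ ⟨∅, fun _ _ _ _ => mem_univ _⟩
    (f := fun x => 1 / (1 + g x ^ 2)) (g := fun _ => 1) (pf := qg ^ 2) (qf := qg ^ 2 + pg ^ 2)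
    (pg := 1) (qg := 1) (by
      refine continuous_const.div (by fun_prop) (fun x => by positivity)) continuous_const hq one_ne_zero
    (by
      intro x
      have : 1 + g x ^ 2 ≠ 0 := by positivity
      simp only [map_add, map_pow, ← hg]
      field_simp) (by simp) (by
      intro x _ h0
      have : 0 < 1 / (1 + g x ^ 2) := by positivity
      change 1 / (1 + g x ^ 2) = 0 at h0
      linarith)
  refine ⟨K, N, hK, fun x => ?_⟩
  have hs : 0 ≤ ∑ i, x i ^ 2 := Finset.sum_nonneg fun i _ => sq_nonneg _
  have := h x (mem_univ _) (K + 1 + ∑ i, x i ^ 2) (by linarith) (by linarith) (by simp; linarith)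
  rw [abs_of_pos (by positivity : 0 < 1 / (1 + g x ^ 2)), mul_one_div, le_div_iff₀ (by positivity)] at this
  have h2 : |g x| ≤ 1 + g x ^ 2 := by
    rw [← sq_abs]; nlinarith [sq_nonneg (|g x| - 1), abs_nonneg (g x)]
  linarith


/-- regulous Łojasiewicz-type lemma: if `C ⊆ X` is closed semi-algebraic and
`f, g` are regulous on `X` with `Z(f) ∩ C ⊆ Z(g)`, there are a positive polynomial function
`h` on `X` and an odd `l` such that `sign(h f + g^l) = sign f` on `C`. -/
theorem regulous_lojasiewicz {n : ℕ} (X : Set (Fin n → ℝ)) (hX : IsRealAlgebraicSet X)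
    (C : Set (Fin n → ℝ)) (hCX : C ⊆ X) (hCc : IsClosed C) (hCsa : IsSemialgebraic C)
    (f g : (Fin n → ℝ) → ℝ) (hf : IsRegulousOn X f) (hg : IsRegulousOn X g)
    (hzero : ∀ x ∈ C, f x = 0 → g x = 0) :
    ∃ (h : MvPolynomial (Fin n) ℝ) (l : ℕ), Odd l ∧
      (∀ x ∈ X, 0 < MvPolynomial.eval x h) ∧
      ∀ x ∈ C, Real.sign (MvPolynomial.eval x h * f x + g x ^ l) = Real.sign (f x) := by
  obtain ⟨F, hF, hfF⟩ := hf
  obtain ⟨G, hG, hgG⟩ := hg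
  obtain ⟨pf, qf, hqf, hpf⟩ := rl_regulous hF
  obtain ⟨pg, qg, hqg, hpg⟩ := rl_regulous hG
  obtain ⟨K, N, hK, hmain⟩ := rl_main hCc (RLSA.of_semialg hCsa) hF.1 hG.1 hqf hqg hpf hpg
    (fun x hx h0 => by
      rw [← hgG x (hCX hx)]; apply hzero x hx; rw [hfF x (hCX hx)]; exact h0)
  obtain ⟨K', N', hK', hgrow⟩ := rl_growth hG.1 hqg hpg
  let S : MvPolynomial (Fin n) ℝ := ∑ i, MvPolynomial.X i ^ 2
  let h : MvPolynomial (Fin n) ℝ :=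
    2 * ((MvPolynomial.C K + S) * (2 * (MvPolynomial.C (K' + 1) + S) ^ N') + 2) ^ (2 * N + 1) + 1
  have hev : ∀ x, MvPolynomial.eval x h = 2 * ((K + ∑ i, x i ^ 2) *
      (2 * (K' + 1 + ∑ i, x i ^ 2) ^ N') + 2) ^ (2 * N + 1) + 1 := by
    intro x
    simp [h, S, map_sum]
  have hsn : ∀ x : Fin n → ℝ, 0 ≤ ∑ i, x i ^ 2 :=
    fun x => Finset.sum_nonneg fun i _ => sq_nonneg _
  have hpos : ∀ x, 0 < MvPolynomial.eval x h := by
    intro x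
    have := hsn x
    rw [hev]
    have h1 : 0 ≤ K + ∑ i, x i ^ 2 := by linarith
    have h2 : 0 ≤ K' + 1 + ∑ i, x i ^ 2 := by linarith
    positivity
  refine ⟨h, 2 * N + 1, ⟨N, rfl⟩, fun x _ => hpos x, fun x hx => ?_⟩
  have hp := hpos x
  by_cases hg0 : g x = 0
  · rw [hg0, zero_pow (by omega), add_zero]
    rcases lt_trichotomy (f x) 0 with h1 | h1 | h1
    · rw [Real.sign_of_neg h1, Real.sign_of_neg (mul_neg_of_pos_of_neg hp h1)]
    · rw [h1, mul_zero]
    · rw [Real.sign_of_pos h1, Real.sign_of_pos (mul_pos hp h1)]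
  have hf0 : f x ≠ 0 := fun h0 => hg0 (hzero x hx h0)
  have key : |g x ^ (2 * N + 1)| < MvPolynomial.eval x h * |f x| := by
    have hs := hsn x
    have hga : 0 < |g x| := abs_pos.mpr hg0
    have hfa : 0 < |f x| := abs_pos.mpr hf0
    have hgb := hgrow x
    have hm := hmain x hx
    rw [← hgG x (hCX hx)] at hgb hm
    rw [← hfF x (hCX hx)] at hm
    rw [hev, abs_pow]
    generalize (∑ i, x i ^ 2) = s at *
    set Gb := 2 * (K' + 1 + s) ^ N' with hGb
    set u := K + s + 2 / |g x| with hu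
    have hd : 0 < 2 / |g x| := by positivity
    have hug : u * |g x| = (K + s) * |g x| + 2 := by
      rw [hu]; field_simp
    have hKs : 0 ≤ K + s := by linarith
    have hu1 : 1 ≤ u := by rw [hu]; linarith
    have h1 := hm u (by rw [hu]; linarith) (by rw [hu]; linarith)
      (by rw [hug]; nlinarith [mul_nonneg hKs hga.le])
    have h2 : u ^ N ≤ u ^ (2 * N + 1) := pow_le_pow_right₀ hu1 (by omega)
    have h3 : 1 ≤ 2 * u ^ (2 * N + 1) * |f x| := by
      refine h1.trans ?_
      gcongr
    have h4 : (u * |g x|) ^ (2 * N + 1) ≤ ((K + s) * Gb + 2) ^ (2 * N + 1) := by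
      rw [hug]
      gcongr
    calc |g x| ^ (2 * N + 1) ≤ |g x| ^ (2 * N + 1) * (2 * u ^ (2 * N + 1) * |f x|) :=
          le_mul_of_one_le_right (by positivity) h3
      _ = 2 * (u * |g x|) ^ (2 * N + 1) * |f x| := by rw [mul_pow]; ring
      _ ≤ 2 * ((K + s) * Gb + 2) ^ (2 * N + 1) * |f x| := by gcongr
      _ < (2 * ((K + s) * Gb + 2) ^ (2 * N + 1) + 1) * |f x| := by nlinarith
  rw [abs_lt] at key
  rcases lt_or_gt_of_ne hf0 with h1 | h1
  · rw [abs_of_neg h1] at key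
    rw [Real.sign_of_neg h1, Real.sign_of_neg (by linarith [key.2])]
  · rw [abs_of_pos h1] at key
    rw [Real.sign_of_pos h1, Real.sign_of_pos (by linarith [key.1])]
end
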